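/- Let p be a prime, K a field of characteristic p, and φ(X) = Σ_{i=d}^{D} c_i X^{p^i} ∈ K[X] a Drinfeld module of special characteristic (1 ≤ d ≤ D, c_d ≠ 0, c_D ≠ 0). Assume φ has positive modular transcendence degree and that Φ[t^∞](K^sep) is finite. Let L be a field extension of K that is separably closed and fully separable over K, and set ψ^∞(L) := ⋂_{n ≥ 0} T_φ^{∘n}(L), the intersection of the images of all iterates of x ↦ φ(x) on L. Then for every g ≥ 1 and every Zariski-closed subset Y of affine g-space defined over L, the set Y(L) ∩ (ψ^∞(L))^g is a finite union of sets of the form b + H, where b ∈ (ψ^∞(L))^g and H is a (possibly trivial) subgroup of the additive group (ψ^∞(L))^g. -/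

import Mathlib

/-- The `𝔽_p`-linear map `T_φ` induced by the additive polynomial
`φ(X) = Σ_{i=d}^{D} c_i X^{p^i}` of a Drinfeld module of special characteristic. -/
noncomputable def specialTphi {L : Type*} [Field L] (p d D : ℕ) (c : ℕ → L) : L → L :=
  fun x => ∑ i ∈ Finset.Icc d D, c i * x ^ (p ^ i)

/-- `x` is algebraic over the prime field `𝔽_p`. -/
def AlgebraicOverPrimeField {K : Type*} [Field K] (p : ℕ) [CharP K p] (x : K) : Prop :=
  ∃ Q : Polynomial (ZMod p), Q ≠ 0 ∧
    Polynomial.eval₂ (ZMod.castHom (dvd_refl p) K) x Q = 0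

/-- `φ = Σ_{i=d}^{D} c_i X^{p^i}` has positive modular transcendence degree: there is no
nonzero `γ` in the algebraic closure of `K` such that every coefficient of `γ⁻¹·φ(γX)`
is algebraic over `𝔽_p`. -/
def PosModularTransc {K : Type*} [Field K] (p : ℕ) [CharP K p] (d D : ℕ) (c : ℕ → K) :
    Prop :=
  ¬ ∃ γ : AlgebraicClosure K, γ ≠ 0 ∧ ∀ j : ℕ,
      AlgebraicOverPrimeField p
        ((Polynomial.C γ⁻¹ *
          ((∑ i ∈ Finset.Icc d D,
            Polynomial.C (algebraMap K (AlgebraicClosure K) (c i)) *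
              Polynomial.X ^ (p ^ i)).comp
            (Polynomial.C γ * Polynomial.X))).coeff j)

/-- `B` is a `p`-basis of `F`: the monomials `∏_{b ∈ S} b^{e_b}` (`S ⊆ B` finite,
`0 ≤ e_b ≤ p − 1`) form a basis of `F` as a vector space over the subfield `F^p` of
`p`-th powers. -/
def IsPBasis (p : ℕ) [Fact p.Prime] (F : Type*) [Field F] [CharP F p] (B : Set F) : Prop :=
  letI Fp : Subfield F := (frobenius F p).fieldRange
  letI fam : {e : ↥B →₀ ℕ // ∀ b, e b < p} → F :=
    fun e => (e : ↥B →₀ ℕ).prod fun b n => (b : F) ^ n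
  LinearIndependent ↥Fp fam ∧ Submodule.span ↥Fp (Set.range fam) = ⊤

/-- `L/K` is fully separable: some `p`-basis of `K` is also a `p`-basis of `L`. -/
def FullySeparable (p : ℕ) [Fact p.Prime] (K L : Type*) [Field K] [Field L] [CharP K p]
    [CharP L p] [Algebra K L] : Prop :=
  ∃ B : Set K, IsPBasis p K B ∧ IsPBasis p L (algebraMap K L '' B)

/-- The zero locus in `M^g` of an ideal of polynomials over `F`, via a ring hom
`F →+* M`. -/
def zeroLocusVia {F M : Type*} [Field F] [CommRing M] {g : ℕ}
    (I : Ideal (MvPolynomial (Fin g) F)) (f : F →+* M) : Set (Fin g → M) :=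
  {x | ∀ q ∈ I, MvPolynomial.eval₂ f x q = 0}

open Polynomial in
/-- The separable part of the `n`-th iterate of `φ`: the additive polynomial `φ_n` with
`φ^n(X) = φ_n(X^{p^{dn}})`. -/
noncomputable def sepIter {L : Type*} [Field L] (p d D : ℕ) : ℕ → (ℕ → L) → L[X]
  | 0, _ => X
  | n + 1, c => ∑ i ∈ Finset.Icc d D,
      C (c i) * (sepIter p d D n fun j => c j ^ p ^ d) ^ p ^ (i - d)

section SepIter

variable {L : Type*} [Field L] (p d D : ℕ)

open Polynomial

theorem aeval_sepIter_add [Fact p.Prime] [CharP L p] {A : Type*} [CommRing A] [Algebra L A]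
    (n : ℕ) (c : ℕ → L) (x y : A) :
    aeval (x + y) (sepIter p d D n c) =
      aeval x (sepIter p d D n c) + aeval y (sepIter p d D n c) := by
  cases subsingleton_or_nontrivial A with
  | inl h => exact Subsingleton.elim _ _
  | inr h =>
    have : CharP A p := charP_of_injective_algebraMap (algebraMap L A).injective p
    induction n generalizing c with
    | zero => simp [sepIter]
    | succ n ih =>
      simp only [sepIter, map_sum, map_mul, map_pow, ih, aeval_C, add_pow_char_pow, mul_add,
        Finset.sum_add_distrib]

theorem aeval_sepIter_zero [Fact p.Prime] {A : Type*} [CommRing A] [Algebra L A]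
    (n : ℕ) (c : ℕ → L) : aeval (0 : A) (sepIter p d D n c) = 0 := by
  induction n generalizing c with
  | zero => simp [sepIter]
  | succ n ih =>
    simp only [sepIter, map_sum, map_mul, map_pow, ih]
    refine Finset.sum_eq_zero fun i _ => ?_
    rw [zero_pow (pow_ne_zero _ (Fact.out : p.Prime).ne_zero), mul_zero]

variable {d D}

theorem derivative_sepIter [Fact p.Prime] [CharP L p] (hdD : d ≤ D) (n : ℕ) (c : ℕ → L)
    (hc : c d ≠ 0) : ∃ a : L, a ≠ 0 ∧ derivative (sepIter p d D n c) = C a := by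
  induction n generalizing c with
  | zero => exact ⟨1, one_ne_zero, by simp [sepIter]⟩
  | succ n ih =>
    obtain ⟨a, ha, h⟩ := ih (fun j => c j ^ p ^ d) (pow_ne_zero _ hc)
    refine ⟨c d * a, mul_ne_zero hc ha, ?_⟩
    rw [sepIter, derivative_sum, Finset.sum_eq_single d]
    · simp [h]
    · intro i hi hne
      have : i - d ≠ 0 := by
        have := Finset.mem_Icc.1 hi
        omega
      simp [derivative_pow, this]
    · intro h
      exact absurd (Finset.mem_Icc.2 ⟨le_rfl, hdD⟩) h

theorem natDegree_sepIter [Fact p.Prime] (hdD : d ≤ D) (n : ℕ) (c : ℕ → L)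
    (hc : c D ≠ 0) : (sepIter p d D n c).natDegree = p ^ ((D - d) * n) := by
  have hp : 1 < p := (Fact.out : p.Prime).one_lt
  induction n generalizing c with
  | zero => simp [sepIter]
  | succ n ih =>
    have ih' := ih (fun j => c j ^ p ^ d) (pow_ne_zero _ hc)
    have hDm : D ∈ Finset.Icc d D := Finset.mem_Icc.2 ⟨hdD, le_rfl⟩
    have hlead : (C (c D) * (sepIter p d D n fun j => c j ^ p ^ d) ^ p ^ (D - d)).natDegree
        = p ^ ((D - d) * (n + 1)) := by
      rw [natDegree_C_mul hc, natDegree_pow, ih', ← pow_add]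
      congr 1
      ring
    rw [sepIter, ← Finset.add_sum_erase _ _ hDm, natDegree_add_eq_left_of_natDegree_lt, hlead]
    rw [hlead]
    refine lt_of_le_of_lt (b := p ^ ((D - d) * (n + 1)) - 1) ?_
      (Nat.sub_lt (pow_pos (by omega) _) one_pos)
    refine natDegree_sum_le_of_forall_le _ _ fun i hi => ?_
    rw [Finset.mem_erase, Finset.mem_Icc] at hi
    refine le_trans (natDegree_C_mul_le _ _) ?_
    rw [natDegree_pow, ih', ← pow_add]
    refine Nat.le_sub_one_of_lt (Nat.pow_lt_pow_right hp ?_)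
    have : i - d < D - d := by omega
    nlinarith

theorem eval_sepIter_pow [Fact p.Prime] [CharP L p] (n : ℕ) (c : ℕ → L) (x : L) :
    eval (x ^ p ^ d) (sepIter p d D n fun j => c j ^ p ^ d) =
      eval x (sepIter p d D n c) ^ p ^ d := by
  induction n generalizing c with
  | zero => simp [sepIter]
  | succ n ih =>
    simp only [sepIter, eval_finsetSum, eval_mul, eval_C, eval_pow, ih, sum_pow_char_pow,
      mul_pow]
    refine Finset.sum_congr rfl fun i _ => ?_
    rw [← pow_mul, ← pow_mul, mul_comm (p ^ d)]

theorem eval_sepIter_add [Fact p.Prime] [CharP L p] (r k : ℕ) (c : ℕ → L) (x : L) :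
    eval (x ^ p ^ (d * k)) (sepIter p d D (r + k) c) =
      (specialTphi p d D c)^[k] (eval x (sepIter p d D r c)) := by
  induction k with
  | zero => simp
  | succ k ih =>
    rw [Function.iterate_succ_apply', ← ih, mul_add, mul_one, pow_add, pow_mul, ← add_assoc,
      sepIter, specialTphi]
    simp only [eval_finsetSum, eval_mul, eval_C, eval_pow, eval_sepIter_pow]
    refine Finset.sum_congr rfl fun i hi => ?_
    rw [← pow_mul, ← pow_add, Nat.add_sub_cancel' (Finset.mem_Icc.1 hi).1]

end SepIter

section VanishingIdeal

open MvPolynomial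

variable {σ k : Type*} [Field k]

theorem mem_map_vanishingIdeal_of_forall_eval_eq_zero {A : Type*} [CommRing A] [Algebra k A]
    {T : Set (σ → k)} {F : MvPolynomial σ A}
    (hF : ∀ t ∈ T, eval (fun i => algebraMap k A (t i)) F = 0) :
    F ∈ Ideal.map (map (algebraMap k A)) (vanishingIdeal k T) := by
  classical
  let b := Module.Basis.ofVectorSpace k A
  let s := F.support.biUnion fun m => (b.repr (F.coeff m)).support
  let G : Module.Basis.ofVectorSpaceIndex k A → MvPolynomial σ k := fun i =>
    ∑ m ∈ F.support, monomial m (b.repr (F.coeff m) i)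
  have hG : ∀ i, G i ∈ vanishingIdeal k T := by
    intro i t ht
    have h := congrArg (fun a => b.repr a i) (hF t ht)
    rw [map_zero, Finsupp.zero_apply, eval_eq, map_sum, Finsupp.finsetSum_apply] at h
    rw [map_sum, ← h]
    refine Finset.sum_congr rfl fun m _ => ?_
    have : coeff m F * ∏ i ∈ m.support, algebraMap k A (t i) ^ m i =
        (∏ i ∈ m.support, t i ^ m i) • coeff m F := by
      rw [Algebra.smul_def, map_prod, mul_comm]
      simp
    rw [this, map_smul, Finsupp.smul_apply, aeval_monomial, smul_eq_mul, mul_comm]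
    rfl
  have hsum : F = ∑ i ∈ s, C (b i) * map (algebraMap k A) (G i) := by
    ext m
    rw [coeff_sum]
    simp only [coeff_C_mul, coeff_map, G, coeff_sum, coeff_monomial, Finset.sum_ite_eq']
    by_cases hm : m ∈ F.support
    · simp only [hm, if_true]
      conv_lhs => rw [← b.linearCombination_repr (F.coeff m), Finsupp.linearCombination_apply,
        Finsupp.sum]
      rw [Finset.sum_subset (s₂ := s) (Finset.subset_biUnion_of_mem
        (fun m => (b.repr (F.coeff m)).support) hm)]
      · exact Finset.sum_congr rfl fun i _ => by rw [Algebra.smul_def, mul_comm]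
      · intro i _ hi
        rw [Finsupp.notMem_support_iff.1 hi, zero_smul]
    · simp only [hm, if_false, map_zero, mul_zero, Finset.sum_const_zero]
      exact notMem_support_iff.1 hm
  rw [hsum]
  exact Ideal.sum_mem _ fun i _ => Ideal.mul_mem_left _ _ (Ideal.mem_map_of_mem _ (hG i))

/-- A polynomial over a `k`-algebra which vanishes on a set of `k`-points also vanishes at
every point at which all polynomials over `k` vanishing on the set do. -/
theorem eval₂_eq_zero_of_forall_mem_vanishingIdeal {A B : Type*} [CommRing A] [Algebra k A]
    [CommRing B] (h : A →+* B) {T : Set (σ → k)} {F : MvPolynomial σ A}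
    (hF : ∀ t ∈ T, eval (fun i => algebraMap k A (t i)) F = 0) (x : σ → B)
    (hx : ∀ f ∈ vanishingIdeal k T, eval₂ (h.comp (algebraMap k A)) x f = 0) :
    eval₂ h x F = 0 := by
  have hle : Ideal.map (map (algebraMap k A)) (vanishingIdeal k T) ≤
      RingHom.ker (eval₂Hom h x) := by
    rw [Ideal.map_le_iff_le_comap]
    intro f hf
    rw [Ideal.mem_comap, RingHom.mem_ker, coe_eval₂Hom, eval₂_map]
    exact hx f hf
  exact hle (mem_map_vanishingIdeal_of_forall_eval_eq_zero hF)

theorem exists_finite_sUnion_isPrime_vanishingIdeal [Finite σ] (T : Set (σ → k)) :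
    ∃ 𝒯 : Set (Set (σ → k)), 𝒯.Finite ∧ (∀ U ∈ 𝒯, (vanishingIdeal k U).IsPrime) ∧
      ⋃₀ 𝒯 = T := by
  suffices h : ∀ I : Ideal (MvPolynomial σ k), ∀ T : Set (σ → k), vanishingIdeal k T = I →
      ∃ 𝒯 : Set (Set (σ → k)), 𝒯.Finite ∧ (∀ U ∈ 𝒯, (vanishingIdeal k U).IsPrime) ∧
        ⋃₀ 𝒯 = T from h _ T rfl
  intro I
  induction I using WellFoundedGT.induction with
  | ind I ih =>
    rintro T rfl
    by_cases hprime : (vanishingIdeal k T).IsPrime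
    · exact ⟨{T}, Set.finite_singleton _, by simpa using hprime, Set.sUnion_singleton T⟩
    rw [Ideal.isPrime_iff, not_and_or, not_not] at hprime
    rcases hprime with htop | hne
    · refine ⟨∅, Set.finite_empty, by simp, ?_⟩
      rw [Set.sUnion_empty, eq_comm, Set.eq_empty_iff_forall_notMem]
      intro t ht
      have h1 : (1 : MvPolynomial σ k) ∈ vanishingIdeal k T := htop ▸ Submodule.mem_top
      simpa using h1 t ht
    · push Not at hne
      obtain ⟨f, g, hfg, hf, hg⟩ := hne
      have key : ∀ q : MvPolynomial σ k, q ∉ vanishingIdeal k T →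
          vanishingIdeal k T < vanishingIdeal k (T ∩ {t | aeval t q = 0}) := fun q hq =>
        lt_of_le_of_ne (vanishingIdeal_anti_mono Set.inter_subset_left) fun he =>
          hq (he ▸ fun t ht => ht.2)
      obtain ⟨𝒯₁, hfin₁, hp₁, hU₁⟩ := ih _ (key f hf) _ rfl
      obtain ⟨𝒯₂, hfin₂, hp₂, hU₂⟩ := ih _ (key g hg) _ rfl
      refine ⟨𝒯₁ ∪ 𝒯₂, hfin₁.union hfin₂, ?_, ?_⟩
      · rintro U (hU | hU)
        exacts [hp₁ U hU, hp₂ U hU]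
      · rw [Set.sUnion_union, hU₁, hU₂, ← Set.inter_union_distrib_left,
          Set.inter_eq_left]
        intro t ht
        have := hfg t ht
        rw [map_mul, mul_eq_zero] at this
        exact this

end VanishingIdeal

section Tensor

open scoped TensorProduct
open Polynomial

theorem mem_range_algebraMap_of_tmul_eq {k L : Type*} [Field k] [Field L] [Algebra k L] {x : L}
    (h : (1 : L) ⊗ₜ[k] x = x ⊗ₜ[k] 1) : x ∈ Set.range (algebraMap k L) := by
  obtain ⟨l, hl⟩ := Module.Projective.exists_dual_ne_zero k (one_ne_zero (α := L))
  have h2 := congrArg (fun t => TensorProduct.rid k L (LinearMap.lTensor L l t)) h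
  simp only [LinearMap.lTensor_tmul, TensorProduct.rid_tmul] at h2
  refine ⟨l x / l 1, ?_⟩
  rw [map_div₀, div_eq_iff (by simpa using hl), mul_comm, ← Algebra.smul_def, ← h2,
    Algebra.smul_def, mul_one]

theorem exists_isUnit_aeval_eq_of_isNilpotent {L R : Type*} [Field L] [CommRing R] [Algebra L R]
    {ε : R} (hε : IsNilpotent ε) {h : L[X]} (hh : h ≠ 0) :
    ∃ u : R, IsUnit u ∧ aeval ε h = ε ^ h.rootMultiplicity 0 * u := by
  obtain ⟨q, hq, hdvd⟩ := exists_eq_pow_rootMultiplicity_mul_and_not_dvd h hh 0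
  refine ⟨aeval ε q, ?_, ?_⟩
  · rw [dvd_iff_isRoot, IsRoot.def] at hdvd
    have hq' : aeval ε q = aeval ε q.divX * ε + algebraMap L R (q.coeff 0) := by
      conv_lhs => rw [← divX_mul_X_add q]
      simp
    rw [← coeff_zero_eq_eval_zero] at hdvd
    rw [hq']
    exact ((Commute.all _ _).isNilpotent_mul_left hε).isUnit_add_right_of_commute
      ((isUnit_iff_ne_zero.2 hdvd).map _) (Commute.all _ _)
  · conv_lhs => rw [hq]
    simp

theorem pow_mem_range_of_aeval_tmul_eq_zero {k L : Type*} [Field k] [Field L] [Algebra k L]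
    (p : ℕ) [Fact p.Prime] [CharP L p] {d D : ℕ} (hdD : d ≤ D) (n : ℕ) (c : ℕ → L)
    (hc : c d ≠ 0) {q : L[X]} (hq : q ≠ 0) {m : L} (hm : eval m (sepIter p d D n c) = 0)
    {M : ℕ} (hM : m ^ p ^ M ∈ Set.range (algebraMap k L))
    (h : aeval (aeval ((1 : L) ⊗ₜ[k] m) (sepIter p d D n c)) q = 0)
    {r : ℕ} (hr : q.natDegree ≤ p ^ r) : m ^ p ^ r ∈ Set.range (algebraMap k L) := by
  have : CharP (L ⊗[k] L) p :=
    charP_of_injective_algebraMap (algebraMap L (L ⊗[k] L)).injective p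
  set φ := sepIter p d D n c with hφ
  set ε : L ⊗[k] L := 1 ⊗ₜ m - m ⊗ₜ 1 with hεdef
  have hpow : ∀ j : ℕ, ε ^ p ^ j = 1 ⊗ₜ (m ^ p ^ j) - (m ^ p ^ j) ⊗ₜ 1 := by
    intro j
    rw [hεdef, sub_pow_char_pow, Algebra.TensorProduct.tmul_pow, Algebra.TensorProduct.tmul_pow,
      one_pow]
  have hnil : IsNilpotent ε := by
    refine ⟨p ^ M, ?_⟩
    obtain ⟨a, ha⟩ := hM
    rw [hpow, ← ha, sub_eq_zero, Algebra.algebraMap_eq_smul_one, TensorProduct.tmul_smul,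
      TensorProduct.smul_tmul']
  have hw : aeval ((1 : L) ⊗ₜ[k] m) φ = aeval ε φ := by
    have h1 : ((1 : L) ⊗ₜ[k] m) = ε + algebraMap L (L ⊗[k] L) m := by
      rw [hεdef, Algebra.TensorProduct.algebraMap_apply]
      simp
    rw [h1, hφ, aeval_sepIter_add, ← hφ, aeval_algebraMap_apply, coe_aeval_eq_eval, hm, map_zero,
      add_zero]
  obtain ⟨a, ha, hder⟩ := derivative_sepIter p hdD n c hc
  have hφ0 : φ ≠ 0 := by
    intro h0
    rw [← hφ, h0, derivative_zero, eq_comm, C_eq_zero] at hder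
    exact ha hder
  have hroot : φ.rootMultiplicity 0 = 1 := by
    have h0 : φ.IsRoot 0 := by
      simpa using aeval_sepIter_zero (A := L) p d D n c
    refine le_antisymm ?_ ((rootMultiplicity_pos hφ0).2 h0)
    by_contra! hlt
    have := (one_lt_rootMultiplicity_iff_isRoot hφ0).1 hlt
    rw [hder] at this
    exact ha (by simpa using this.2)
  obtain ⟨u, hu, hu'⟩ := exists_isUnit_aeval_eq_of_isNilpotent hnil hφ0
  rw [hroot, pow_one] at hu'
  have hwnil : IsNilpotent (aeval ε φ) := hu' ▸ (Commute.all _ _).isNilpotent_mul_right hnil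
  obtain ⟨v, hv, hv'⟩ := exists_isUnit_aeval_eq_of_isNilpotent hwnil hq
  rw [← hw, h, hw, hu', mul_pow, mul_assoc, eq_comm] at hv'
  have hμ : ε ^ q.rootMultiplicity 0 = 0 :=
    (((hu.pow _).mul hv).mul_left_eq_zero).1 hv'
  refine mem_range_algebraMap_of_tmul_eq ?_
  rw [← sub_eq_zero, ← hpow]
  refine pow_eq_zero_of_le ?_ hμ
  classical
  refine le_trans ?_ hr
  rw [← count_roots]
  exact (Multiset.count_le_card _ _).trans (card_roots' q)

end Tensor

section Torsion

variable {L : Type*} [Field L] (p d D : ℕ)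

theorem pow_char_pow_injective [Fact p.Prime] [CharP L p] (j : ℕ) :
    Function.Injective fun x : L => x ^ p ^ j :=
  iterateFrobenius_inj L p j

open Polynomial in
theorem exists_card_le_of_eval_sepIter_eq_zero [Fact p.Prime] [CharP L p] {d D : ℕ}
    (hdD : d ≤ D) (c : ℕ → L) (hc : c D ≠ 0)
    (htor : {x : L | ∃ n, (specialTphi p d D c)^[n] x = 0}.Finite) (r : ℕ) :
    ∃ C : ℕ, ∀ n, r ≤ n → ∀ s : Finset L, (∀ m ∈ s, eval m (sepIter p d D n c) = 0 ∧
      ∃ v : L, v ^ p ^ (d * n) = m ^ p ^ (d * r)) → s.card ≤ C := by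
  classical
  set E : Set L := (fun u => eval u (sepIter p d D r c)) ⁻¹'
    {x : L | ∃ n, (specialTphi p d D c)^[n] x = 0} with hE
  have hfin : E.Finite := by
    refine htor.preimage' fun b _ => ?_
    have hdeg : (sepIter p d D r c - C b) ≠ 0 := by
      intro h0
      have h1 := natDegree_sepIter p hdD r c hc
      rw [sub_eq_zero] at h0
      rw [h0, natDegree_C] at h1
      exact absurd h1.symm (pow_pos (Fact.out : p.Prime).pos _).ne'
    refine (rootSet_finite (sepIter p d D r c - C b) L).subset fun u hu => ?_
    rw [mem_rootSet]
    refine ⟨hdeg, ?_⟩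
    simpa [sub_eq_zero] using hu
  refine ⟨hfin.toFinset.card, fun n hn s hs => ?_⟩
  have hsub : s ⊆ hfin.toFinset.image fun u => u ^ p ^ (d * (n - r)) := by
    intro m hm
    obtain ⟨h0, v, hv⟩ := hs m hm
    have hmv : m = v ^ p ^ (d * (n - r)) := by
      refine pow_char_pow_injective (L := L) p (d * r) ?_
      show m ^ p ^ (d * r) = (v ^ p ^ (d * (n - r))) ^ p ^ (d * r)
      rw [← hv, ← pow_mul, ← pow_add, ← mul_add, Nat.sub_add_cancel hn]
    rw [Finset.mem_image]
    refine ⟨v, hfin.mem_toFinset.2 ⟨n - r, ?_⟩, hmv.symm⟩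
    rw [← eval_sepIter_add, Nat.add_sub_cancel' hn, ← hmv, h0]
  exact (Finset.card_le_card hsub).trans Finset.card_image_le

end Torsion

section FullySeparable

theorem map_specialTphi_iterate {E F : Type*} [Field E] [Field F] (f : E →+* F) (p d D : ℕ)
    (c : ℕ → E) (n : ℕ) (x : E) :
    f ((specialTphi p d D c)^[n] x) = (specialTphi p d D fun i => f (c i))^[n] (f x) := by
  induction n with
  | zero => rfl
  | succ n ih =>
    rw [Function.iterate_succ_apply', Function.iterate_succ_apply', ← ih]
    simp [specialTphi]

variable {K L : Type*} [Field K] [Field L] [Algebra K L] (p : ℕ) [Fact p.Prime] [CharP K p]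
  [CharP L p]

open IntermediateField in
theorem mem_separableClosure_of_pow_mem (hfs : FullySeparable p K L) {x : L}
    (hx : x ^ p ∈ separableClosure K L) : x ∈ separableClosure K L := by
  obtain ⟨B, ⟨-, hK⟩, hL, -⟩ := hfs
  have : ExpChar K p := .prime Fact.out
  let S : Subfield L := (separableClosure K L).toSubfield.map (frobenius L p)
  let mon : {e : ↥(algebraMap K L '' B) →₀ ℕ // ∀ b, e b < p} → L := fun e =>
    (e : ↥(algebraMap K L '' B) →₀ ℕ).prod fun b n => (b : L) ^ n
  have hSpow : ∀ y ∈ separableClosure K L, y ^ p ∈ S := fun y hy => ⟨y, hy, rfl⟩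
  have hKspan : ∀ y : K, algebraMap K L y ∈ Submodule.span S (Set.range mon) := by
    intro y
    have hy : y ∈ (⊤ : Submodule (frobenius K p).fieldRange K) := Submodule.mem_top
    rw [← hK] at hy
    induction hy using Submodule.span_induction with
    | mem y hy =>
      obtain ⟨e, rfl⟩ := hy
      let f : ↥B → ↥(algebraMap K L '' B) := fun b => ⟨algebraMap K L b, b, b.2, rfl⟩
      have hf : Function.Injective f := fun a b hab =>
        Subtype.ext ((algebraMap K L).injective (congrArg Subtype.val hab))
      refine Submodule.subset_span ⟨⟨e.1.mapDomain f, ?_⟩, ?_⟩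
      · rintro ⟨_, b, hb, rfl⟩
        have : (⟨algebraMap K L b, b, hb, rfl⟩ : ↥(algebraMap K L '' B)) = f ⟨b, hb⟩ := rfl
        rw [this, Finsupp.mapDomain_apply hf]
        exact e.2 _
      · show (e.1.mapDomain f).prod _ = _
        rw [Finsupp.prod_mapDomain_index_inj hf, map_finsuppProd]
        simp [f]
    | zero => rw [map_zero]; exact Submodule.zero_mem _
    | add a b _ _ ha hb => rw [map_add]; exact Submodule.add_mem _ ha hb
    | smul r a _ ha =>
      obtain ⟨-, r, rfl⟩ := r
      have h1 : algebraMap K L r ^ p ∈ S := hSpow _ ((separableClosure K L).algebraMap_mem r)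
      have := Submodule.smul_mem _ (⟨_, h1⟩ : S) ha
      rw [Subfield.smul_def] at this ⊢
      simpa [frobenius_def] using this
  have hSspan : ∀ y ∈ separableClosure K L, y ∈ Submodule.span S (Set.range mon) := by
    intro y hy
    have hy' : IsSeparable K y := mem_separableClosure_iff.1 hy
    have h1 : y ∈ K⟮y ^ p⟯ := by
      have h2 : K⟮y⟯ = K⟮y ^ p⟯ := by
        simpa using adjoin_simple_eq_adjoin_pow_expChar_pow_of_isSeparable K L hy' p 1
      rw [← h2]
      exact mem_adjoin_simple_self K y
    have halg : IsAlgebraic K (y ^ p) := hy'.isIntegral.isAlgebraic.pow p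
    rw [← mem_toSubalgebra, adjoin_simple_toSubalgebra_of_isAlgebraic halg,
      Algebra.adjoin_singleton_eq_range_aeval] at h1
    obtain ⟨P, hP⟩ := h1
    rw [← hP]
    show Polynomial.aeval (y ^ p) P ∈ _
    rw [Polynomial.aeval_eq_sum_range]
    refine Submodule.sum_mem _ fun i _ => ?_
    have h3 : (y ^ p) ^ i ∈ S := S.pow_mem (hSpow y hy) i
    rw [Algebra.smul_def, mul_comm]
    exact Submodule.smul_mem _ (⟨_, h3⟩ : S) (hKspan _)
  obtain ⟨a, ha⟩ := Finsupp.mem_span_range_iff_exists_finsupp.1 (hSspan _ hx)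
  have hle : ∀ s : S, (s : L) ∈ (frobenius L p).fieldRange := fun s => by
    obtain ⟨z, -, hz⟩ := s.2
    exact ⟨z, hz⟩
  let a' : {e : ↥(algebraMap K L '' B) →₀ ℕ // ∀ b, e b < p} →₀ (frobenius L p).fieldRange :=
    a.mapRange (fun s : S => ⟨(s : L), hle s⟩) (by rfl)
  let e0 : {e : ↥(algebraMap K L '' B) →₀ ℕ // ∀ b, e b < p} :=
    ⟨0, fun _ => (Fact.out : p.Prime).pos⟩
  have hxp : x ^ p ∈ (frobenius L p).fieldRange := ⟨x, frobenius_def p x⟩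
  have h1 : a' = Finsupp.single e0 ⟨x ^ p, hxp⟩ := by
    refine linearIndependent_iff_injective_finsuppLinearCombination.1 hL ?_
    rw [Finsupp.linearCombination_single, Finsupp.linearCombination_apply]
    refine (Finsupp.sum_mapRange_index fun i => zero_smul _ (mon i)).trans ?_
    refine ha.trans ?_
    rw [Subfield.smul_def]
    simp [e0]
  have h2 : ((a e0 : S) : L) = x ^ p := by
    have := congrArg (fun f => ((f e0 : (frobenius L p).fieldRange) : L)) h1
    simpa [a'] using this
  obtain ⟨z, hz, hz'⟩ := (a e0).2
  rw [h2] at hz'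
  have : z = x := frobenius_inj L p hz'
  exact this ▸ hz

theorem IsAlgebraic.mem_separableClosure_of_fullySeparable (hfs : FullySeparable p K L) {x : L}
    (hx : IsAlgebraic K x) : x ∈ separableClosure K L := by
  have : ExpChar K p := .prime Fact.out
  obtain ⟨g, h1, n, h2⟩ := (minpoly.irreducible hx.isIntegral).hasSeparableContraction p
  have h3 : x ^ p ^ n ∈ separableClosure K L := by
    rw [mem_separableClosure_iff]
    refine h1.of_dvd (minpoly.dvd K _ ?_)
    rw [← Polynomial.expand_aeval, h2, minpoly.aeval]
  clear h2
  induction n with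
  | zero => simpa using h3
  | succ n ih =>
    rw [pow_succ, pow_mul] at h3
    exact ih (mem_separableClosure_of_pow_mem p hfs h3)

/-- Torsion points in a fully separable extension are separable over the base, hence there
are no more of them than in the separable closure of the base. -/
theorem finite_torsion_of_fullySeparable (hfs : FullySeparable p K L) {d D : ℕ} (hdD : d ≤ D)
    (c : ℕ → K) (hc : c D ≠ 0)
    (htor : {x : AlgebraicClosure K | x ∈ separableClosure K (AlgebraicClosure K) ∧
      ∃ n : ℕ, (specialTphi p d D (fun i => algebraMap K (AlgebraicClosure K) (c i)))^[n] x
        = 0}.Finite) :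
    {x : L | ∃ n, (specialTphi p d D fun i => algebraMap K L (c i))^[n] x = 0}.Finite := by
  classical
  let ι : separableClosure K L →ₐ[K] AlgebraicClosure K :=
    IsAlgClosed.lift
  have hsep : ∀ x : L, (∃ n, (specialTphi p d D fun i => algebraMap K L (c i))^[n] x = 0) →
      x ∈ separableClosure K L := by
    rintro x ⟨n, hx⟩
    refine IsAlgebraic.mem_separableClosure_of_fullySeparable p hfs ?_
    have : IsAlgebraic K (x ^ p ^ (d * n)) := by
      refine ⟨sepIter p d D n c, ?_, ?_⟩
      · intro h0
        have h1 := natDegree_sepIter p hdD n c hc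
        rw [h0, Polynomial.natDegree_zero] at h1
        exact (pow_pos (Fact.out : p.Prime).pos _).ne h1
      · have h1 : ∀ n : ℕ, ∀ c : ℕ → K, (sepIter p d D n c).map (algebraMap K L) =
            sepIter p d D n fun i => algebraMap K L (c i) := by
          intro n
          induction n with
          | zero => intro c; simp [sepIter]
          | succ n ih => intro c; simp [sepIter, Polynomial.map_sum, ih]
        rw [← Polynomial.eval_map_algebraMap, h1]
        have := eval_sepIter_add p (d := d) (D := D) 0 n (fun i => algebraMap K L (c i)) x
        rw [zero_add] at this
        rw [this]
        simpa [sepIter] using hx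
    exact this.of_pow (pow_pos (Fact.out : p.Prime).pos _)
  refine Set.Finite.of_finite_image (f := fun x => if h : x ∈ separableClosure K L then
    ι ⟨x, h⟩ else 0) (htor.subset ?_) ?_
  · rintro _ ⟨x, hx, rfl⟩
    have hx' := hsep x hx
    simp only [hx', dif_pos]
    constructor
    · rw [mem_separableClosure_iff]
      have h1 : IsSeparable K (⟨x, hx'⟩ : separableClosure K L) :=
        (isSeparable_map_iff (separableClosure K L).val (separableClosure K L).val.injective).1
          (mem_separableClosure_iff.1 hx')
      exact h1.map ι ι.injective
    · obtain ⟨n, hn⟩ := hx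
      refine ⟨n, ?_⟩
      have h1 := map_specialTphi_iterate (algebraMap (separableClosure K L) L) p d D
        (fun i => algebraMap K (separableClosure K L) (c i)) n ⟨x, hx'⟩
      have h2 := map_specialTphi_iterate (ι : separableClosure K L →+* AlgebraicClosure K) p d D
        (fun i => algebraMap K (separableClosure K L) (c i)) n ⟨x, hx'⟩
      have h3 : (specialTphi p d D fun i => algebraMap K (separableClosure K L) (c i))^[n]
          ⟨x, hx'⟩ = 0 := by
        refine (algebraMap (separableClosure K L) L).injective ?_
        rw [h1, map_zero]
        exact hn
      rw [h3, map_zero] at h2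
      simpa using h2.symm
  · intro x hx y hy hxy
    have hx' := hsep x hx
    have hy' := hsep y hy
    simp only [hx', hy', dif_pos] at hxy
    exact congrArg Subtype.val (ι.injective hxy)

end FullySeparable

section Modular

open Polynomial in
theorem PosModularTransc.ne {K : Type*} [Field K] {p : ℕ} [Fact p.Prime] [CharP K p]
    {d D : ℕ} (hd : 1 ≤ d) {c : ℕ → K} (hcd : c d ≠ 0) (h : PosModularTransc p d D c) :
    d ≠ D := by
  rintro rfl
  have hp : 1 < p ^ d := Nat.one_lt_pow (by omega) (Fact.out : p.Prime).one_lt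
  have hc : algebraMap K (AlgebraicClosure K) (c d) ≠ 0 := by simpa using hcd
  obtain ⟨γ, hγ⟩ := IsAlgClosed.exists_pow_nat_eq (algebraMap K (AlgebraicClosure K) (c d))⁻¹
    (show 0 < p ^ d - 1 by omega)
  have hγ0 : γ ≠ 0 := by
    rintro rfl
    rw [zero_pow (by omega)] at hγ
    exact inv_ne_zero hc hγ.symm
  refine h ⟨γ, hγ0, fun j => ?_⟩
  have h1 : γ ^ p ^ d = γ * (algebraMap K (AlgebraicClosure K) (c d))⁻¹ := by
    rw [← hγ, ← pow_succ', Nat.sub_add_cancel hp.le]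
  have h2 : (C γ⁻¹ * ((∑ i ∈ Finset.Icc d d, C (algebraMap K (AlgebraicClosure K) (c i)) *
      X ^ (p ^ i)).comp (C γ * X))) = X ^ p ^ d := by
    rw [Finset.Icc_self, Finset.sum_singleton, mul_comp, C_comp, X_pow_comp, mul_pow, ← C_pow,
      h1, ← mul_assoc, ← mul_assoc, ← C_mul, ← C_mul]
    field_simp
    simp
  rw [h2, coeff_X_pow]
  split_ifs
  · exact ⟨X - C 1, X_sub_C_ne_zero 1, by simp⟩
  · exact ⟨X, X_ne_zero, by simp⟩

end Modular

section FieldDegree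

open Polynomial IntermediateField
open scoped IntermediateField.algebraAdjoinAdjoin

variable {k Ω : Type*} [Field k] [Field Ω] [Algebra k Ω]

theorem linearIndependent_pow_adjoin_aeval {z : Ω} (hz : Transcendental k z) {φ : k[X]}
    (hφ : 0 < φ.natDegree) :
    LinearIndependent k⟮aeval z φ⟯ fun j : Fin φ.natDegree => z ^ (j : ℕ) := by
  rw [← LinearIndependent.iff_fractionRing (Algebra.adjoin k {aeval z φ}),
    Fintype.linearIndependent_iff]
  intro g hg
  have hmem : ∀ j, ∃ r : k[X], aeval (aeval z φ) r = (g j : Ω) := by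
    intro j
    have : (g j : Ω) ∈ (aeval (aeval z φ) : k[X] →ₐ[k] Ω).range :=
      Algebra.adjoin_singleton_eq_range_aeval k (aeval z φ) ▸ (g j).2
    exact this
  choose r hr using hmem
  have h0 : ∑ j, (r j).comp φ * X ^ (j : ℕ) = 0 := by
    refine transcendental_iff.1 hz _ ?_
    rw [map_sum, ← hg]
    refine Finset.sum_congr rfl fun j _ => ?_
    rw [map_mul, aeval_comp, hr, Algebra.smul_def]
    simp
  have hdeg := degree_sum_eq_of_disjoint (fun j : Fin φ.natDegree => (r j).comp φ * X ^ (j : ℕ))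
    Finset.univ ?_
  · rw [h0, degree_zero, eq_comm, Finset.sup_eq_bot_iff] at hdeg
    intro j
    have h1 := degree_eq_bot.1 (hdeg j (Finset.mem_univ j))
    have h2 : (r j).comp φ = 0 := by
      simpa using h1
    have h3 : r j = 0 := by
      rcases comp_eq_zero_iff.1 h2 with h | ⟨-, h⟩
      · exact h
      · rw [h, natDegree_C] at hφ
        exact absurd hφ (lt_irrefl _)
    have := hr j
    rw [h3, map_zero] at this
    exact Subtype.ext this.symm
  · rintro i ⟨-, hi⟩ j ⟨-, hj⟩ hij
    simp only [Function.onFun, Function.comp_apply]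
    rw [degree_eq_natDegree hi, degree_eq_natDegree hj]
    intro h
    have hi' := left_ne_zero_of_mul hi
    have hj' := left_ne_zero_of_mul hj
    rw [natDegree_mul hi' (by simp), natDegree_mul hj' (by simp), natDegree_comp, natDegree_comp,
      natDegree_X_pow, natDegree_X_pow] at h
    apply hij
    have h2 : (((r i).natDegree * φ.natDegree + i) % φ.natDegree) =
      (((r j).natDegree * φ.natDegree + j) % φ.natDegree) := by
      rw [Nat.cast_inj.1 h]
    rw [Nat.mul_add_mod_self_right, Nat.mul_add_mod_self_right, Nat.mod_eq_of_lt i.2,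
      Nat.mod_eq_of_lt j.2] at h2
    exact Fin.ext h2

theorem natDegree_le_natDegree_minpoly {z : Ω} (hz : Transcendental k z) {φ : k[X]}
    (hφ : 0 < φ.natDegree) (hint : IsIntegral k⟮aeval z φ⟯ z) :
    φ.natDegree ≤ (minpoly k⟮aeval z φ⟯ z).natDegree := by
  have h := linearIndependent_pow_adjoin_aeval hz hφ
  by_contra! hlt
  have h1 : minpoly k⟮aeval z φ⟯ z = 0 := by
    have h2 := minpoly.aeval k⟮aeval z φ⟯ z
    rw [aeval_eq_sum_range' hlt, ← Fin.sum_univ_eq_sum_range (fun i => coeff _ i • z ^ i)] at h2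
    have h3 := Fintype.linearIndependent_iff.1 h _ h2
    ext i
    rw [coeff_zero]
    by_cases hi : i < φ.natDegree
    · exact congrArg Subtype.val (h3 ⟨i, hi⟩)
    · rw [coeff_eq_zero_of_natDegree_lt (by omega)]
  exact minpoly.ne_zero hint h1

theorem finrank_adjoin_image_le {ι : Type*} [DecidableEq ι] (v : ι → Ω) (e : ι → ℕ)
    (h : ∀ i, ∃ P : k[X], P ≠ 0 ∧ aeval (v i) P = 0 ∧ P.natDegree ≤ e i) (s : Finset ι) :
    FiniteDimensional k (adjoin k (v '' s)) ∧
      Module.finrank k (adjoin k (v '' s)) ≤ ∏ i ∈ s, e i := by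
  induction s using Finset.induction_on with
  | empty =>
    have h0 : adjoin k (v '' ↑(∅ : Finset ι)) = ⊥ := by simp
    rw [h0]
    exact ⟨inferInstance, by simp⟩
  | insert a s ha ih =>
    obtain ⟨h1, h2⟩ := ih
    obtain ⟨P, hP0, hP, hPe⟩ := h a
    have hint : IsIntegral k (v a) := isAlgebraic_iff_isIntegral.1 ⟨P, hP0, hP⟩
    have h3 : adjoin k (v '' ↑(insert a s)) = k⟮v a⟯ ⊔ adjoin k (v '' s) := by
      rw [Finset.coe_insert, Set.image_insert_eq, ← adjoin_union, Set.insert_eq]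
    have := adjoin.finiteDimensional hint
    rw [h3]
    refine ⟨inferInstance, (finrank_sup_le _ _).trans ?_⟩
    rw [Finset.prod_insert ha]
    refine Nat.mul_le_mul ?_ h2
    rw [adjoin.finrank hint]
    exact (natDegree_le_of_dvd (minpoly.dvd k _ hP) hP0).trans hPe

theorem natDegree_minpoly_le_finrank_mul (M : Type*) [Field M] [Algebra k M] [Algebra M Ω]
    [IsScalarTower k M Ω] [FiniteDimensional k M] {z : Ω} (hz : IsIntegral k z) :
    (minpoly k z).natDegree ≤ Module.finrank k M * (minpoly M z).natDegree := by
  have hz' : IsIntegral M z := hz.tower_top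
  have := adjoin.finiteDimensional hz'
  have : FiniteDimensional k M⟮z⟯ := .trans k M _
  have : IsScalarTower k M⟮z⟯ Ω := .of_algebraMap_eq fun x => by
    rw [IsScalarTower.algebraMap_apply k M Ω, IsScalarTower.algebraMap_apply k M M⟮z⟯]
    rfl
  have h3 := minpoly.natDegree_le (A := k) (AdjoinSimple.gen M z)
  rw [← Module.finrank_mul_finrank k M, adjoin.finrank hz'] at h3
  rwa [← minpoly.algebraMap_eq (algebraMap M⟮z⟯ Ω).injective, AdjoinSimple.algebraMap_gen] at h3

/-- If `z` is transcendental over `k`, then adjoining boundedly algebraic elements to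
`k(φ(z))` lowers the degree of `z` by a bounded factor only. -/
theorem natDegree_le_prod_mul_natDegree_minpoly {z : Ω} (hz : Transcendental k z) {φ : k[X]}
    (hφ : 0 < φ.natDegree) {ι : Type*} [Fintype ι] (v : ι → Ω) (e : ι → ℕ)
    (h : ∀ i, ∃ P : k⟮aeval z φ⟯[X], P ≠ 0 ∧ aeval (v i) P = 0 ∧ P.natDegree ≤ e i) :
    φ.natDegree ≤
      (∏ i, e i) * (minpoly (adjoin k⟮aeval z φ⟯ (Set.range v)) z).natDegree := by
  classical
  have hint : IsIntegral k⟮aeval z φ⟯ z := by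
    refine isAlgebraic_iff_isIntegral.1 ⟨φ.map (algebraMap k _) -
      C ⟨aeval z φ, mem_adjoin_simple_self k _⟩, ?_, ?_⟩
    · intro h0
      have := congrArg natDegree h0
      rw [natDegree_sub_C, natDegree_map, natDegree_zero] at this
      omega
    · rw [map_sub, aeval_map_algebraMap, aeval_C]
      exact sub_self _
  refine (natDegree_le_natDegree_minpoly hz hφ hint).trans ?_
  obtain ⟨h1, h2⟩ := finrank_adjoin_image_le v e h Finset.univ
  rw [Finset.coe_univ, Set.image_univ] at h1 h2
  exact (natDegree_minpoly_le_finrank_mul (adjoin k⟮aeval z φ⟯ (Set.range v)) hint).trans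
    (Nat.mul_le_mul_right _ h2)

end FieldDegree

section Translates

open Polynomial

theorem separable_of_derivative_eq_C {k : Type*} [Field k] {f : k[X]} {a : k} (ha : a ≠ 0)
    (h : derivative f = C a) : f.Separable := by
  rw [separable_def']
  refine ⟨0, C a⁻¹, ?_⟩
  rw [h, ← C_mul, inv_mul_cancel₀ ha, zero_mul, zero_add, C_1]

variable {L Ω M : Type*} [Field L] [IsSepClosed L] [Field Ω] [Algebra L Ω]

theorem exists_algebraMap_eq_of_aeval_eq_zero {φ : L[X]} {a : L} (ha : a ≠ 0)
    (hφ : derivative φ = C a) {x : Ω} (hx : aeval x φ = 0) : ∃ m : L, algebraMap L Ω m = x := by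
  have hsep := separable_of_derivative_eq_C ha hφ
  exact (IsSepClosed.splits_of_separable φ hsep).mem_range_of_isRoot
    hsep.ne_zero (by simpa [aeval_def] using hx)

variable [IsAlgClosed Ω] [Field M] [Algebra M Ω]

/-- Conjugates of `z a` over a field containing `φ(z)` arise from translations of `z` by zeros
of `φ`. -/
theorem natDegree_minpoly_le_of_translates {σ : Type*} (ℓ : L →+* M)
    (hℓ : (algebraMap M Ω).comp ℓ = algebraMap L Ω) {φ : L[X]} {a : L} (ha : a ≠ 0)
    (hφ : derivative φ = C a)
    (hadd : ∀ x y : Ω, aeval (x + y) φ = aeval x φ + aeval y φ)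
    {z : σ → Ω} (hz : ∀ i, ∃ y : M, algebraMap M Ω y = aeval (z i) φ)
    {B : Set σ} (hB : ∀ b ∈ B, ∃ y : M, algebraMap M Ω y = z b) (i₀ : σ) (N : ℕ)
    (hN : ∀ s : Finset L, (∀ x ∈ s, ∃ m : σ → L, m i₀ = x ∧ (∀ i, eval (m i) φ = 0) ∧
      (∀ b ∈ B, m b = 0) ∧ ∀ f : MvPolynomial σ L, MvPolynomial.aeval z f = 0 →
        MvPolynomial.aeval (fun i => z i + algebraMap L Ω (m i)) f = 0) → s.card ≤ N) :
    (minpoly M (z i₀)).natDegree ≤ N := by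
  classical
  have hmap : ∀ x : Ω, aeval x (φ.map ℓ) = aeval x φ := by
    intro x
    rw [aeval_def, eval₂_map, hℓ, aeval_def]
  have hpol : ∀ i, ∃ f : M[X], f.Separable ∧ aeval (z i) f = 0 := by
    intro i
    obtain ⟨y, hy⟩ := hz i
    refine ⟨φ.map ℓ - C y, ?_, ?_⟩
    · refine separable_of_derivative_eq_C (a := ℓ a) (by simpa using ha) ?_
      rw [derivative_sub, derivative_C, sub_zero, derivative_map, hφ, map_C]
    · rw [map_sub, aeval_C, hmap, hy, sub_self]
  have hint : ∀ i, IsIntegral M (z i) := by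
    intro i
    obtain ⟨f, hf, hf0⟩ := hpol i
    exact isAlgebraic_iff_isIntegral.1 ⟨f, hf.ne_zero, hf0⟩
  have hsep : (minpoly M (z i₀)).Separable := by
    obtain ⟨f, hf, hf0⟩ := hpol i₀
    exact hf.of_dvd (minpoly.dvd M _ hf0)
  have hcard := card_rootSet_eq_natDegree (K := Ω) hsep (IsAlgClosed.splits _)
  have hroot : ∀ w ∈ (minpoly M (z i₀)).rootSet Ω, ∃ m : σ → L,
      algebraMap L Ω (m i₀) = w - z i₀ ∧ (∀ i, eval (m i) φ = 0) ∧
      (∀ b ∈ B, m b = 0) ∧ ∀ f : MvPolynomial σ L, MvPolynomial.aeval z f = 0 →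
        MvPolynomial.aeval (fun i => z i + algebraMap L Ω (m i)) f = 0 := by
    intro w hw
    have hw0 := ((mem_rootSet).1 hw).2
    have hmem : ∀ i, z i ∈ IntermediateField.adjoin M (Set.range z) := fun i =>
      IntermediateField.subset_adjoin M _ ⟨i, rfl⟩
    obtain ⟨h, hh⟩ := IntermediateField.exists_algHom_adjoin_of_splits_of_aeval
      (S := Set.range z) (K := Ω) (by
        rintro _ ⟨i, rfl⟩
        exact ⟨hint i, IsAlgClosed.splits _⟩) (hmem i₀) hw0
    set z' : σ → Ω := fun i => h ⟨z i, hmem i⟩ with hz'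
    have hφz : ∀ i, aeval (z' i) φ = aeval (z i) φ := by
      intro i
      obtain ⟨y, hy⟩ := hz i
      have h1 : aeval (⟨z i, hmem i⟩ : IntermediateField.adjoin M (Set.range z)) (φ.map ℓ) =
          algebraMap M _ y := by
        refine (algebraMap (IntermediateField.adjoin M (Set.range z)) Ω).injective ?_
        rw [← aeval_algebraMap_apply, ← IsScalarTower.algebraMap_apply, hy, ← hmap]
        rfl
      rw [← hmap, hz', aeval_algHom_apply, h1, AlgHom.commutes, hy]
    have hroots : ∀ i, ∃ m : L, algebraMap L Ω m = z' i - z i := by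
      intro i
      refine exists_algebraMap_eq_of_aeval_eq_zero ha hφ ?_
      have := hadd (z' i - z i) (z i)
      rw [sub_add_cancel, hφz] at this
      exact right_eq_add.1 this
    choose m hm using hroots
    have hzm : ∀ i, z i + algebraMap L Ω (m i) = z' i := fun i => by rw [hm]; ring
    refine ⟨m, by rw [hm, ← hh], fun i => ?_, fun b hb => ?_, fun f hf => ?_⟩
    · have h1 := hadd (z i) (algebraMap L Ω (m i))
      rw [hzm, hφz, left_eq_add, aeval_algebraMap_apply, coe_aeval_eq_eval] at h1
      exact (algebraMap L Ω).injective (h1.trans (map_zero _).symm)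
    · obtain ⟨y, hy⟩ := hB b hb
      refine (algebraMap L Ω).injective ?_
      rw [hm, map_zero, sub_eq_zero]
      have h1 : (⟨z b, hmem b⟩ : IntermediateField.adjoin M (Set.range z)) = algebraMap M _ y :=
        Subtype.ext hy.symm
      show h ⟨z b, hmem b⟩ = z b
      rw [h1, AlgHom.commutes, hy]
    · simp only [hzm]
      rw [MvPolynomial.aeval_def, ← hℓ] at hf ⊢
      have h1 : MvPolynomial.eval₂ ((algebraMap M (IntermediateField.adjoin M (Set.range z))).comp
          ℓ) (fun i => ⟨z i, hmem i⟩) f = 0 := by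
        refine (algebraMap (IntermediateField.adjoin M (Set.range z)) Ω).injective ?_
        rw [MvPolynomial.eval₂_comp_left, map_zero, ← hf]
        rfl
      have h2 := congrArg h h1
      rw [map_zero, ← RingHom.coe_coe, MvPolynomial.eval₂_comp_left, ← RingHom.comp_assoc,
        AlgHom.comp_algebraMap_of_tower] at h2
      exact h2
  choose! m hm using hroot
  rw [← hcard, ← Set.toFinset_card]
  refine le_trans (le_of_eq ?_) (hN (((minpoly M (z i₀)).rootSet Ω).toFinset.image
    fun w => m w i₀) ?_)
  · rw [Finset.card_image_of_injOn]
    intro w hw w' hw' hww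
    have h1 := (hm w (by simpa using hw)).1
    have h2 := (hm w' (by simpa using hw')).1
    simp only at hww
    rw [hww, h2] at h1
    exact (sub_left_inj.1 h1).symm
  · intro x hx
    obtain ⟨w, hw, rfl⟩ := Finset.mem_image.1 hx
    exact ⟨m w, rfl, (hm w (by simpa using hw)).2⟩

end Translates

section Stabilizer

open MvPolynomial
open scoped TensorProduct

theorem exists_aeval_X_mem_of_finite_zeroLocus {k σ : Type*} [Field k] [Finite σ]
    (J : Ideal (MvPolynomial σ k)) (hJ : (zeroLocus (AlgebraicClosure k) J).Finite) (i : σ) :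
    ∃ q : Polynomial k, q ≠ 0 ∧ Polynomial.aeval (X i : MvPolynomial σ k) q ∈ J := by
  set q : Polynomial k := ∏ x ∈ hJ.toFinset, minpoly k (x i) with hq
  have hint : ∀ x : AlgebraicClosure k, IsIntegral k x := fun x =>
    (Algebra.IsAlgebraic.isAlgebraic x).isIntegral
  have hq0 : q ≠ 0 := Finset.prod_ne_zero_iff.2 fun x _ => minpoly.ne_zero (hint _)
  have hmem : Polynomial.aeval (X i : MvPolynomial σ k) q ∈ J.radical := by
    rw [← vanishingIdeal_zeroLocus_eq_radical (K := AlgebraicClosure k) J]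
    intro x hx
    rw [← Polynomial.aeval_algHom_apply, aeval_X, hq, map_prod]
    exact Finset.prod_eq_zero (hJ.mem_toFinset.2 hx) (minpoly.aeval k (x i))
  obtain ⟨N, hN⟩ := hmem
  exact ⟨q ^ N, pow_ne_zero _ hq0, by rwa [map_pow]⟩

theorem aeval_aeval_X_add_C {R A σ : Type*} [CommRing R] [CommRing A] [Algebra R A] (x : σ → A)
    (s : σ → R) (f : MvPolynomial σ R) :
    aeval x (aeval (fun i => X i + C (s i)) f : MvPolynomial σ R) =
      aeval (fun i => x i + algebraMap R A (s i)) f := by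
  rw [← AlgHom.comp_apply, comp_aeval]
  simp

theorem aeval_aeval_polynomial_aeval_X {R A σ : Type*} [CommRing R] [CommRing A] [Algebra R A]
    (x : σ → A) (φ : Polynomial R) (f : MvPolynomial σ R) :
    aeval x (aeval (fun i => Polynomial.aeval (X i : MvPolynomial σ R) φ) f) =
      aeval (fun i => Polynomial.aeval (x i) φ) f := by
  rw [← AlgHom.comp_apply, comp_aeval]
  simp only [← Polynomial.aeval_algHom_apply, aeval_X]

theorem eval_aeval_C_add_X {R A σ : Type*} [CommRing R] [CommRing A] [Algebra R A] (w x : σ → A)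
    (f : MvPolynomial σ R) :
    eval x (aeval (fun i => C (w i) + X i) f : MvPolynomial σ A) =
      aeval (fun i => w i + x i) f := by
  induction f using MvPolynomial.induction_on with
  | C a => simp [MvPolynomial.algebraMap_apply]
  | add f g hf hg => simp only [map_add, hf, hg]
  | mul_X f i hf => simp [hf]

variable {L : Type*} [Field L] (p : ℕ) [Fact p.Prime] [CharP L p] {d D : ℕ} {σ : Type*}

/-- A translation `m` by zeros of `φ_n` preserving a set `T` of `p^{dn}`-th powers gives a point
`φ_n(1 ⊗ m)` of `L ⊗ L` stabilizing every set with the same vanishing ideal as `φ_n(T)`. -/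
theorem aeval_tmul_eq_zero_of_translate (n : ℕ) (c : ℕ → L) {S T : Set (σ → L)}
    (hT : ∀ t ∈ T, ∀ i, ∃ v : L, v ^ p ^ (d * n) = t i)
    (hTS : vanishingIdeal L ((fun t i => Polynomial.eval (t i) (sepIter p d D n c)) '' T) =
      vanishingIdeal L S) {m : σ → L}
    (hm : ∀ f ∈ vanishingIdeal L T, ∀ t ∈ T, aeval (fun i => m i + t i) f = 0)
    {f : MvPolynomial σ L} (hf : f ∈ vanishingIdeal L S) {s : σ → L} (hs : s ∈ S) :
    aeval (fun i => Polynomial.aeval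
      ((1 : L) ⊗ₜ[(iterateFrobenius L p (d * n)).fieldRange] m i) (sepIter p d D n c) +
        algebraMap L _ (s i)) f = 0 := by
  set k := (iterateFrobenius L p (d * n)).fieldRange with hk
  set φ := sepIter p d D n c with hφ
  set w : σ → L ⊗[k] L := fun i => Polynomial.aeval ((1 : L) ⊗ₜ[k] m i) φ with hw
  have h1 : ∀ t ∈ T, aeval (fun i => w i + algebraMap L _ (Polynomial.eval (t i) φ)) f = 0 := by
    intro t ht
    let T' : Set (σ → k) := {t | (fun i => (t i : L)) ∈ T}
    let F : MvPolynomial σ L := aeval (fun i => Polynomial.aeval (X i : MvPolynomial σ L) φ) f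
    have hF : ∀ t ∈ T, aeval t F = 0 := by
      intro t ht
      rw [aeval_aeval_polynomial_aeval_X]
      rw [← hTS] at hf
      simpa using hf _ ⟨t, ht, rfl⟩
    have hmemk : ∀ t ∈ T, ∀ i, t i ∈ k := fun t ht i => hT t ht i
    have h2 := eval₂_eq_zero_of_forall_mem_vanishingIdeal (k := k) (A := L)
      (algebraMap L (L ⊗[k] L)) (T := T') (F := F) (fun t ht => hF _ ht)
      (fun i => (1 : L) ⊗ₜ[k] (m i + t i)) (by
        intro g hg
        have h3 : map (algebraMap k L) g ∈ vanishingIdeal L T := by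
          intro u hu
          have := hg (fun i => ⟨u i, hmemk u hu i⟩) hu
          rw [aeval_map_algebraMap]
          have h4 := congrArg (algebraMap k L) this
          rw [map_zero, ← aeval_algebraMap_apply] at h4
          exact h4
        have h4 := hm _ h3 t ht
        rw [aeval_map_algebraMap] at h4
        have h5 := congrArg (Algebra.TensorProduct.includeRight : L →ₐ[k] L ⊗[k] L) h4
        rw [map_zero, ← AlgHom.comp_apply, comp_aeval, aeval_def] at h5
        rw [← h5, ← IsScalarTower.algebraMap_eq]
        rfl)
    rw [← aeval_def, aeval_aeval_polynomial_aeval_X] at h2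
    rw [← h2]
    congr 2
    funext i
    have h3 : (1 : L) ⊗ₜ[k] (m i + t i) = (1 : L) ⊗ₜ[k] m i + algebraMap L _ (t i) := by
      rw [TensorProduct.tmul_add, Algebra.TensorProduct.algebraMap_apply, Algebra.algebraMap_self,
        RingHom.id_apply]
      congr 1
      have h4 : t i = (⟨t i, hmemk t ht i⟩ : k) • (1 : L) := by
        rw [Subfield.smul_def, smul_eq_mul, mul_one]
      rw [h4, TensorProduct.tmul_smul, TensorProduct.smul_tmul']
    rw [h3, hφ, aeval_sepIter_add, Polynomial.aeval_algebraMap_apply,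
      Polynomial.coe_aeval_eq_eval]
  have h2 := eval₂_eq_zero_of_forall_mem_vanishingIdeal (k := L) (A := L ⊗[k] L)
    (RingHom.id _) (T := (fun t i => Polynomial.eval (t i) φ) '' T)
    (F := aeval (fun i => C (w i) + X i) f) (by
      rintro _ ⟨t, ht, rfl⟩
      rw [eval_aeval_C_add_X]
      exact h1 t ht)
    (fun i => algebraMap L _ (s i)) (by
      intro g hg
      rw [hTS] at hg
      have := aeval_algebraMap_apply (L ⊗[k] L) s g
      rw [hg s hs, map_zero] at this
      exact this)
  rw [eval₂_id, eval_aeval_C_add_X] at h2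
  exact h2

theorem exists_pow_eq_pow_of_finite [Finite σ] (hd : 1 ≤ d) (c : ℕ → L) (hcd : c d ≠ 0)
    (hdD : d ≤ D) {S : Set (σ → L)} {B : Set σ}
    (hfin : {x : σ → AlgebraicClosure L | (∀ f ∈ vanishingIdeal L S, ∀ s ∈ S,
      aeval (fun i => x i + algebraMap L _ (s i)) f = 0) ∧ ∀ b ∈ B, x b = 0}.Finite) (i₀ : σ) :
    ∃ r, ∀ (n : ℕ) (T : Set (σ → L)), (∀ t ∈ T, ∀ i, ∃ v : L, v ^ p ^ (d * n) = t i) →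
      vanishingIdeal L ((fun t i => Polynomial.eval (t i) (sepIter p d D n c)) '' T) =
        vanishingIdeal L S → ∀ m : σ → L,
      (∀ i, Polynomial.eval (m i) (sepIter p d D n c) = 0) → (∀ b ∈ B, m b = 0) →
      (∀ f ∈ vanishingIdeal L T, ∀ t ∈ T, aeval (fun i => m i + t i) f = 0) →
      ∃ v : L, v ^ p ^ (d * n) = m i₀ ^ p ^ (d * r) := by
  let G : Set (MvPolynomial σ L) :=
    {F | (∃ f ∈ vanishingIdeal L S, ∃ s ∈ S, aeval (fun i => X i + C (s i)) f = F) ∨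
      ∃ b ∈ B, X b = F}
  obtain ⟨q, hq, hqJ⟩ := exists_aeval_X_mem_of_finite_zeroLocus (Ideal.span G)
    (hfin.subset (by
      intro x hx
      refine ⟨fun f hf s hs => ?_, fun b hb => ?_⟩
      · rw [← aeval_aeval_X_add_C]
        exact hx _ (Ideal.subset_span (Or.inl ⟨f, hf, s, hs, rfl⟩))
      · rw [← aeval_X (R := L) x b]
        exact hx _ (Ideal.subset_span (Or.inr ⟨b, hb, rfl⟩)))) i₀
  refine ⟨q.natDegree, fun n T hT hTS m hm hmB hmT => ?_⟩
  set φ := sepIter p d D n c with hφ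
  set k := (iterateFrobenius L p (d * n)).fieldRange with hk
  set w : σ → L ⊗[k] L := fun i => Polynomial.aeval ((1 : L) ⊗ₜ[k] m i) φ with hw
  have hker : Ideal.span G ≤ RingHom.ker (aeval w : MvPolynomial σ L →ₐ[L] L ⊗[k] L) := by
    rw [Ideal.span_le]
    rintro _ (⟨f, hf, s, hs, rfl⟩ | ⟨b, hb, rfl⟩)
    · rw [SetLike.mem_coe, RingHom.mem_ker, aeval_aeval_X_add_C]
      exact aeval_tmul_eq_zero_of_translate p n c hT hTS hmT hf hs
    · rw [SetLike.mem_coe, RingHom.mem_ker, aeval_X, hw]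
      simp only [hmB b hb, TensorProduct.tmul_zero, hφ, aeval_sepIter_zero]
  have h0 : Polynomial.aeval (w i₀) q = 0 := by
    have := hker hqJ
    rwa [RingHom.mem_ker, ← Polynomial.aeval_algHom_apply, aeval_X] at this
  obtain ⟨u, hu⟩ := pow_mem_range_of_aeval_tmul_eq_zero (k := k) p hdD n c hcd hq (hm i₀)
    (M := d * n) (r := d * q.natDegree) ⟨⟨m i₀ ^ p ^ (d * n), ⟨m i₀, rfl⟩⟩, rfl⟩ h0
    ((Nat.le_mul_of_pos_left _ hd).trans
      (Nat.lt_pow_self (Fact.out : p.Prime).one_lt).le)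
  obtain ⟨v, hv⟩ := u.2
  exact ⟨v, by rw [← hu]; exact hv⟩

end Stabilizer

section AlgebraicDependence

open MvPolynomial IntermediateField

theorem exists_vanishingIdeal_image_eq {L : Type*} [Field L] (p : ℕ) [Fact p.Prime] [CharP L p]
    {d D : ℕ} {σ : Type*} [Finite σ] (n : ℕ) (c : ℕ → L) {S : Set (σ → L)}
    (hS : ∀ s ∈ S, ∀ i, s i ∈ Set.range ((specialTphi p d D c)^[n]))
    (hP : (vanishingIdeal L S).IsPrime) :
    ∃ T : Set (σ → L), (∀ t ∈ T, ∀ i, ∃ v : L, v ^ p ^ (d * n) = t i) ∧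
      (vanishingIdeal L T).IsPrime ∧
      vanishingIdeal L ((fun t i => Polynomial.eval (t i) (sepIter p d D n c)) '' T) =
        vanishingIdeal L S := by
  set φ : (σ → L) → σ → L := fun t i => Polynomial.eval (t i) (sepIter p d D n c) with hφ
  obtain ⟨𝒯, hfin, hprime, hU⟩ := exists_finite_sUnion_isPrime_vanishingIdeal
    {t : σ → L | (∀ i, ∃ v : L, v ^ p ^ (d * n) = t i) ∧ φ t ∈ S}
  have hmem : ∀ U ∈ 𝒯, ∀ t ∈ U, (∀ i, ∃ v : L, v ^ p ^ (d * n) = t i) ∧ φ t ∈ S := by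
    intro U hUT t ht
    have : t ∈ ⋃₀ 𝒯 := ⟨U, hUT, ht⟩
    rwa [hU] at this
  have hle : hfin.toFinset.inf (fun U => vanishingIdeal L (φ '' U)) ≤ vanishingIdeal L S := by
    intro f hf s hs
    choose u hu using hS s hs
    have ht : (fun i => u i ^ p ^ (d * n)) ∈ ⋃₀ 𝒯 := by
      rw [hU]
      refine ⟨fun i => ⟨u i, rfl⟩, ?_⟩
      convert hs using 1
      funext i
      have := eval_sepIter_add p (d := d) (D := D) 0 n c (u i)
      rw [Nat.zero_add] at this
      rw [← hu i]
      simpa [sepIter] using this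
    obtain ⟨U, hUT, htU⟩ := ht
    have hs' : s ∈ φ '' U := by
      refine ⟨_, htU, ?_⟩
      funext i
      have := eval_sepIter_add p (d := d) (D := D) 0 n c (u i)
      rw [Nat.zero_add] at this
      rw [← hu i]
      simpa [sepIter] using this
    exact Finset.inf_le (f := fun U => vanishingIdeal L (φ '' U)) (hfin.mem_toFinset.2 hUT) hf s hs'
  obtain ⟨U, hUT, hUle⟩ := (Ideal.IsPrime.inf_le' hP).1 hle
  rw [Set.Finite.mem_toFinset] at hUT
  refine ⟨U, fun t ht => (hmem U hUT t ht).1, hprime U hUT, le_antisymm hUle ?_⟩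
  apply vanishingIdeal_anti_mono
  rintro _ ⟨t, ht, rfl⟩
  exact (hmem U hUT t ht).2

variable {L R Ω : Type*} [Field L] [CommRing R] [Algebra L R] [Field Ω] [Algebra L Ω]

theorem exists_polynomial_of_map_mem {ι : R →ₐ[L] Ω} (hι : Function.Injective ι)
    (A : Subalgebra L R) {F : Type*} [Field F] [Algebra F Ω]
    (h : ∀ a ∈ A, ι a ∈ (algebraMap F Ω).range) {x : R} {P : Polynomial A} (hP : P ≠ 0)
    (hx : Polynomial.aeval x P = 0) :
    ∃ Q : Polynomial F, Q ≠ 0 ∧ Polynomial.aeval (ι x) Q = 0 ∧ Q.natDegree ≤ P.natDegree := by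
  let e := RingEquiv.ofBijective (algebraMap F Ω).rangeRestrict
    ⟨fun a b hab => (algebraMap F Ω).injective (congrArg Subtype.val hab),
      (algebraMap F Ω).rangeRestrict_surjective⟩
  let j₀ : A →+* (algebraMap F Ω).range :=
    ((ι : R →+* Ω).comp A.val.toRingHom).codRestrict _ fun a => h a a.2
  let j : A →+* F := (e.symm : _ →+* F).comp j₀
  have hj : (algebraMap F Ω).comp j = (ι : R →+* Ω).comp (algebraMap A R) := by
    ext a
    exact congrArg Subtype.val (e.apply_symm_apply (j₀ a))
  have hjinj : Function.Injective j := by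
    intro a b hab
    have := congrArg (algebraMap F Ω) hab
    rw [← RingHom.comp_apply, ← RingHom.comp_apply, hj] at this
    exact Subtype.ext (hι this)
  refine ⟨P.map j, (Polynomial.map_ne_zero_iff hjinj).2 hP, ?_, Polynomial.natDegree_map_le⟩
  rw [Polynomial.aeval_def, Polynomial.eval₂_map, hj]
  have := congrArg ι hx
  rw [map_zero, Polynomial.aeval_def] at this
  rw [← this]
  exact (Polynomial.hom_eval₂ P (algebraMap A R) (ι : R →+* Ω) x).symm

theorem isAlgebraic_adjoin_of_map {ι : R →ₐ[L] Ω} (hι : Function.Injective ι) {s : Set R} {x : R}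
    (h : IsAlgebraic (Algebra.adjoin L (ι '' s)) (ι x)) : IsAlgebraic (Algebra.adjoin L s) x := by
  let e : Algebra.adjoin L s ≃ₐ[L] Algebra.adjoin L (ι '' s) :=
    (Subalgebra.equivMapOfInjective _ ι hι).trans (Subalgebra.equivOfEq _ _ (AlgHom.map_adjoin ι s))
  exact h.of_ringHom_of_comp_eq e ι e.surjective hι rfl

open scoped IntermediateField.algebraAdjoinAdjoin in
theorem isAlgebraic_adjoin_of_forall_isAlgebraic {s t : Set Ω} {y : Ω}
    (hs : ∀ z ∈ s, IsAlgebraic (IntermediateField.adjoin L t) z)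
    (hy : IsAlgebraic (IntermediateField.adjoin L s) y) : IsAlgebraic (Algebra.adjoin L t) y := by
  rw [IsFractionRing.isAlgebraic_iff (Algebra.adjoin L t) (IntermediateField.adjoin L t) Ω]
  let A := algebraicClosure (IntermediateField.adjoin L t) Ω
  have hle : IntermediateField.adjoin L s ≤ A.restrictScalars L :=
    IntermediateField.adjoin_le_iff.2 fun z hz => mem_algebraicClosure_iff.2 (hs z hz)
  have hyA : IsAlgebraic A y := by
    let j : IntermediateField.adjoin L s →+* A := (IntermediateField.inclusion hle).toRingHom
    exact hy.ringHom_of_comp_eq j (RingHom.id Ω) j.injective rfl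
  exact hyA.restrictScalars (IntermediateField.adjoin L t)

theorem pow_le_prod_natDegree_mul [IsSepClosed L] [IsAlgClosed Ω] (p : ℕ) [Fact p.Prime]
    [CharP L p] {d D : ℕ} (hdD : d < D) (n : ℕ) (c : ℕ → L) (hcd : c d ≠ 0) (hcD : c D ≠ 0)
    {σ : Type*} [Fintype σ] {ι : R →ₐ[L] Ω} (hι : Function.Injective ι) {x : σ → R} {z : σ → Ω}
    (hxz : ∀ i, ι (x i) = Polynomial.aeval (z i) (sepIter p d D n c)) {B : Set σ} {a : σ}
    (ha : ¬ IsAlgebraic (Algebra.adjoin L (x '' B)) (x a))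
    (P : σ → Polynomial (Algebra.adjoin L (x '' insert a B))) (hP : ∀ i, P i ≠ 0)
    (hPx : ∀ i, Polynomial.aeval (x i) (P i) = 0) (N : ℕ)
    (hN : ∀ s : Finset L, (∀ u ∈ s, ∃ m : σ → L, m a = u ∧
      (∀ i, Polynomial.eval (m i) (sepIter p d D n c) = 0) ∧ (∀ b ∈ B, m b = 0) ∧
      ∀ f : MvPolynomial σ L, aeval z f = 0 →
        aeval (fun i => z i + algebraMap L Ω (m i)) f = 0) → s.card ≤ N) :
    p ^ ((D - d) * n) ≤ (∏ i, (P i).natDegree) * N := by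
  set φ := sepIter p d D n c with hφ
  set E := IntermediateField.adjoin L (z '' B) with hE
  have hzE : ∀ b ∈ B, z b ∈ E := fun b hb => IntermediateField.subset_adjoin _ _ ⟨b, hb, rfl⟩
  have hxE : ∀ b ∈ B, ι (x b) ∈ E := by
    intro b hb
    rw [hxz]
    have := Polynomial.aeval_algebraMap_apply Ω (⟨z b, hzE b hb⟩ : E) φ
    exact this ▸ Subtype.property _
  have hdeg : (φ.map (algebraMap L E)).natDegree = p ^ ((D - d) * n) := by
    rw [Polynomial.natDegree_map, hφ, natDegree_sepIter p hdD.le n c hcD]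
  have haeval : ∀ w : Ω, Polynomial.aeval w (φ.map (algebraMap L E)) = Polynomial.aeval w φ :=
    fun w => Polynomial.aeval_map_algebraMap E w φ
  have hφ0 : φ.natDegree ≠ 0 := by
    rw [hφ, natDegree_sepIter p hdD.le n c hcD]
    exact (pow_pos (Fact.out : p.Prime).pos _).ne'
  have hztr : Transcendental E (z a) := by
    intro hza
    apply ha
    apply isAlgebraic_adjoin_of_map hι
    apply isAlgebraic_adjoin_of_forall_isAlgebraic (s := z '' B)
    · rintro _ ⟨b, hb, rfl⟩
      set F := IntermediateField.adjoin L (ι '' (x '' B)) with hF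
      have hmem : ι (x b) ∈ F := IntermediateField.subset_adjoin _ _ ⟨_, ⟨b, hb, rfl⟩, rfl⟩
      apply IsAlgebraic.of_aeval (φ.map (algebraMap L F))
      · rwa [Polynomial.natDegree_map]
      · rw [mem_nonZeroDivisors_iff_ne_zero, Polynomial.leadingCoeff_ne_zero]
        intro h0
        apply hφ0
        rw [← Polynomial.natDegree_map (f := algebraMap L F), h0, Polynomial.natDegree_zero]
      · rw [Polynomial.aeval_map_algebraMap, ← hxz]
        exact isAlgebraic_algebraMap (⟨_, hmem⟩ : F)
    · rw [hxz]
      let A := algebraicClosure E Ω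
      have := Polynomial.aeval_algebraMap_apply Ω
        (⟨z a, mem_algebraicClosure_iff.2 hza⟩ : A) (φ.map (algebraMap L E))
      rw [← haeval]
      exact this ▸ mem_algebraicClosure_iff.1 (Subtype.property _)
  have hpos : 0 < (φ.map (algebraMap L E)).natDegree := by
    rw [hdeg]
    exact pow_pos (Fact.out : p.Prime).pos _
  have hxa : ι (x a) = Polynomial.aeval (z a) (φ.map (algebraMap L E)) := by rw [haeval, hxz]
  have hmain := natDegree_le_prod_mul_natDegree_minpoly hztr hpos (fun i => ι (x i))
    (fun i => (P i).natDegree) (by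
      intro i
      refine exists_polynomial_of_map_mem hι _ ?_ (hP i) (hPx i)
      intro u hu
      let G := (IntermediateField.adjoin E
        {Polynomial.aeval (z a) (φ.map (algebraMap L E))}).restrictScalars L
      have hle : Algebra.adjoin L (x '' insert a B) ≤ G.toSubalgebra.comap ι := by
        rw [Algebra.adjoin_le_iff]
        rintro _ ⟨b, rfl | hb, rfl⟩
        · change ι (x b) ∈ IntermediateField.adjoin E _
          rw [hxa]
          exact IntermediateField.mem_adjoin_simple_self E _
        · change ι (x b) ∈ IntermediateField.adjoin E _
          exact (IntermediateField.adjoin E _).algebraMap_mem ⟨_, hxE b hb⟩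
      exact ⟨⟨_, hle hu⟩, rfl⟩)
  rw [hdeg] at hmain
  refine hmain.trans (Nat.mul_le_mul_left _ ?_)
  obtain ⟨α, hα, hder⟩ := derivative_sepIter p hdD.le n c hcd
  refine natDegree_minpoly_le_of_translates (L := L) (M := IntermediateField.adjoin
    (IntermediateField.adjoin E {Polynomial.aeval (z a) (φ.map (algebraMap L E))})
    (Set.range fun i => ι (x i))) ((algebraMap E _).comp (algebraMap L E)) rfl hα hder
    (fun u v => ?_) (fun i => ?_) (B := B) (fun b hb => ?_) a N hN
  · exact aeval_sepIter_add p d D n c u v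
  · rw [← hxz]
    exact ⟨⟨_, IntermediateField.subset_adjoin _ _ ⟨i, rfl⟩⟩, rfl⟩
  · exact ⟨algebraMap E _ ⟨z b, hzE b hb⟩, rfl⟩

end AlgebraicDependence

section FiniteStabilizer

open MvPolynomial

/-- If the translations of the closure of `S` fixing the coordinates in `B` are finite in number,
then all coordinates on `S` are algebraic over those in `B`. -/
theorem isAlgebraic_of_finite_translates {L : Type*} [Field L] [IsSepClosed L] (p : ℕ)
    [Fact p.Prime] [CharP L p] {d D : ℕ} (hd : 1 ≤ d) (hdD : d < D) (c : ℕ → L) (hcd : c d ≠ 0)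
    (hcD : c D ≠ 0) (htor : {x : L | ∃ n, (specialTphi p d D c)^[n] x = 0}.Finite)
    {σ : Type*} [Finite σ] {S : Set (σ → L)}
    (hS : ∀ s ∈ S, ∀ i n, s i ∈ Set.range ((specialTphi p d D c)^[n]))
    (hP : (vanishingIdeal L S).IsPrime) {B₀ : Set σ}
    (hfin : {x : σ → AlgebraicClosure L | (∀ f ∈ vanishingIdeal L S, ∀ s ∈ S,
      aeval (fun i => x i + algebraMap L _ (s i)) f = 0) ∧ ∀ b ∈ B₀, x b = 0}.Finite) (i₀ : σ) :
    IsAlgebraic (Algebra.adjoin L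
      ((fun i => Ideal.Quotient.mk (vanishingIdeal L S) (X i)) '' B₀))
      (Ideal.Quotient.mk (vanishingIdeal L S) (X i₀)) := by
  have := Fintype.ofFinite σ
  set I := vanishingIdeal L S with hI
  set x : σ → MvPolynomial σ L ⧸ I := fun i => Ideal.Quotient.mk I (X i) with hx
  by_contra hna
  obtain ⟨B, hB₀, ⟨⟨a, ha⟩, hmax⟩⟩ := Finite.exists_le_maximal
    (p := fun B : Set σ => ∃ i, ¬ IsAlgebraic (Algebra.adjoin L (x '' B)) (x i)) ⟨i₀, hna⟩
  have haB : a ∉ B := fun h => ha (isAlgebraic_algebraMap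
    (⟨x a, Algebra.subset_adjoin ⟨a, h, rfl⟩⟩ : Algebra.adjoin L (x '' B)))
  have halg : ∀ i, IsAlgebraic (Algebra.adjoin L (x '' insert a B)) (x i) := by
    by_contra! h
    exact haB (hmax h (Set.subset_insert a B) (Set.mem_insert a B))
  choose P hP0 hPx using halg
  obtain ⟨r, hr⟩ := exists_pow_eq_pow_of_finite p hd c hcd hdD.le (hfin.subset
    (t := {x : σ → AlgebraicClosure L | (∀ f ∈ vanishingIdeal L S, ∀ s ∈ S,
      aeval (fun i => x i + algebraMap L _ (s i)) f = 0) ∧ ∀ b ∈ B, x b = 0})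
    fun x hx => ⟨hx.1, fun b hb => hx.2 b (hB₀ hb)⟩) a
  obtain ⟨N, hN⟩ := exists_card_le_of_eval_sepIter_eq_zero p hdD.le c hcD htor r
  have hbound : ∀ n, r ≤ n → p ^ ((D - d) * n) ≤ (∏ i, (P i).natDegree) * N := by
    intro n hn
    obtain ⟨T, hT, hQ, hTS⟩ := exists_vanishingIdeal_image_eq p n c (fun s hs i => hS s hs i n) hP
    set Q := vanishingIdeal L T with hQT
    let Ω := AlgebraicClosure (FractionRing (MvPolynomial σ L ⧸ Q))
    let z : σ → Ω := fun i => algebraMap (MvPolynomial σ L ⧸ Q) Ω (Ideal.Quotient.mk Q (X i))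
    have hinj : Function.Injective (algebraMap (MvPolynomial σ L ⧸ Q) Ω) := by
      rw [IsScalarTower.algebraMap_eq _ (FractionRing (MvPolynomial σ L ⧸ Q)) Ω]
      exact (algebraMap (FractionRing (MvPolynomial σ L ⧸ Q)) Ω).injective.comp (IsFractionRing.injective _ _)
    have hz : ∀ f : MvPolynomial σ L, aeval z f = 0 ↔ f ∈ Q := by
      intro f
      have h1 : aeval z f = algebraMap (MvPolynomial σ L ⧸ Q) Ω (Ideal.Quotient.mk Q f) := by
        have h2 : aeval z = (IsScalarTower.toAlgHom L (MvPolynomial σ L ⧸ Q) Ω).comp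
            (Ideal.Quotient.mkₐ L Q) := by
          ext i
          simp [z]
        rw [h2]
        rfl
      rw [h1, map_eq_zero_iff _ hinj, Ideal.Quotient.eq_zero_iff_mem]
    set φ := sepIter p d D n c with hφ
    have hy : ∀ f : MvPolynomial σ L, aeval (fun i => Polynomial.aeval (z i) φ) f = 0 ↔ f ∈ I := by
      intro f
      rw [← aeval_aeval_polynomial_aeval_X, hz, hI, ← hTS]
      refine ⟨?_, ?_⟩
      · rintro h _ ⟨t, ht, rfl⟩
        have := h t ht
        rwa [aeval_aeval_polynomial_aeval_X] at this
      · intro h t ht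
        rw [aeval_aeval_polynomial_aeval_X]
        exact h _ ⟨t, ht, rfl⟩
    let ι : (MvPolynomial σ L ⧸ I) →ₐ[L] Ω := Ideal.Quotient.liftₐ I
      (aeval fun i => Polynomial.aeval (z i) φ) fun f hf => (hy f).2 hf
    have hι : Function.Injective ι := by
      rw [injective_iff_map_eq_zero]
      intro u hu
      obtain ⟨f, rfl⟩ := Ideal.Quotient.mk_surjective u
      exact Ideal.Quotient.eq_zero_iff_mem.2 ((hy f).1 hu)
    have hxz : ∀ i, ι (x i) = Polynomial.aeval (z i) φ := fun i => aeval_X _ i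
    refine pow_le_prod_natDegree_mul p hdD n c hcd hcD hι hxz ha P hP0 hPx N fun s hs => ?_
    refine hN n hn s fun u hu => ?_
    obtain ⟨m, rfl, hm, hmB, hmz⟩ := hs u hu
    refine ⟨hm a, hr n T hT hTS m hm hmB fun f hf t ht => ?_⟩
    have h1 := hmz f ((hz f).2 hf)
    rw [← aeval_aeval_X_add_C, hz] at h1
    have h2 := h1 t ht
    rw [aeval_aeval_X_add_C] at h2
    simpa only [add_comm, Algebra.algebraMap_self, RingHom.id_apply] using h2
  set M := (∏ i, (P i).natDegree) * N with hM
  have h1 := hbound (r + M) (Nat.le_add_right _ _)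
  have h2 : r + M < p ^ (r + M) := Nat.lt_pow_self (Fact.out : p.Prime).one_lt
  have h3 : p ^ (r + M) ≤ p ^ ((D - d) * (r + M)) :=
    Nat.pow_le_pow_right (Fact.out : p.Prime).pos
      (Nat.le_mul_of_pos_left _ (Nat.sub_pos_of_lt hdD))
  lia

end FiniteStabilizer

section Translates

open MvPolynomial

theorem neg_eq_nsmul_of_charP {M σ : Type*} [Ring M] (p : ℕ) [Fact p.Prime] [CharP M p]
    (x : σ → M) : -x = (p - 1) • x := by
  rw [neg_eq_iff_add_eq_zero, ← succ_nsmul',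
    Nat.sub_add_cancel (Fact.out : p.Prime).one_le]
  funext i
  simp

/-- An additive submonoid of functions into a ring of positive characteristic is a subgroup. -/
def AddSubmonoid.toAddSubgroupOfCharP {M σ : Type*} [Ring M] (p : ℕ) [Fact p.Prime] [CharP M p]
    (H : AddSubmonoid (σ → M)) : AddSubgroup (σ → M) :=
  { H with
    neg_mem' := fun {x} hx => by
      rw [neg_eq_nsmul_of_charP p x]
      exact H.nsmul_mem hx _ }

/-- The translations by points with coordinates in `A` which map `S` into its closure. -/
def closureTranslates {L σ : Type*} [Field L] (A : Type*) [CommRing A] [Algebra L A] (p : ℕ)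
    [Fact p.Prime] [CharP A p] (S : Set (σ → L)) : AddSubgroup (σ → A) :=
  AddSubmonoid.toAddSubgroupOfCharP p
    { carrier := {x | ∀ f ∈ vanishingIdeal L S, ∀ s ∈ S,
        aeval (fun i => x i + algebraMap L A (s i)) f = 0}
      zero_mem' := fun f hf s hs => by
        have := aeval_algebraMap_apply A s f
        rw [hf s hs, map_zero] at this
        simp only [Pi.zero_apply, zero_add]
        exact this
      add_mem' := fun {x y} hx hy f hf s hs => by
        have := eval₂_eq_zero_of_forall_mem_vanishingIdeal (k := L) (A := A) (RingHom.id A)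
          (T := S) (F := aeval (fun i => C (x i) + X i) f)
          (fun t ht => by
            rw [eval_aeval_C_add_X]
            exact hx f hf t ht)
          (fun i => y i + algebraMap L A (s i)) (fun f hf => hy f hf s hs)
        rw [eval₂_id, eval_aeval_C_add_X] at this
        simpa only [Pi.add_apply, add_assoc] using this }

theorem mem_closureTranslates {L σ A : Type*} [Field L] [CommRing A] [Algebra L A] {p : ℕ}
    [Fact p.Prime] [CharP A p] {S : Set (σ → L)} {x : σ → A} :
    x ∈ closureTranslates A p S ↔ ∀ f ∈ vanishingIdeal L S, ∀ s ∈ S,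
      aeval (fun i => x i + algebraMap L A (s i)) f = 0 := Iff.rfl

theorem exists_forall_eq_of_minimal {A σ : Type*} [AddCommGroup A] [Finite σ]
    (G : AddSubgroup (σ → A)) :
    ∃ (B : Set σ) (H : B → Set A), {x | x ∈ G ∧ ∀ b ∈ B, x b = 0}.Finite ∧
      (∀ b, (H b).Infinite) ∧ ∀ u : B → A, (∀ b, u b ∈ H b) → ∃ x ∈ G, ∀ b : B, x b = u b := by
  classical
  obtain ⟨B, -, hB, hmin⟩ := exists_minimal_le_of_wellFoundedLT
    (fun B : Set σ => {x | x ∈ G ∧ ∀ b ∈ B, x b = 0}.Finite) Set.univ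
    ((Set.finite_singleton (0 : σ → A)).subset fun x hx => funext fun i => hx.2 i trivial)
  have := Fintype.ofFinite B
  refine ⟨B, fun b => (fun x : σ → A => x b) '' {x | x ∈ G ∧ ∀ b' ∈ B \ {(b : σ)}, x b' = 0},
    hB, fun b hfin => ?_, fun u hu => ?_⟩
  · refine (hmin (y := B \ {(b : σ)}) ?_ Set.sdiff_subset b.2).2 rfl
    refine Set.Finite.of_finite_fibers (fun x : σ → A => x b) hfin ?_
    rintro _ ⟨x₀, hx₀, rfl⟩
    refine (hB.image fun x => x + x₀).subset ?_
    rintro x ⟨hx, hxb⟩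
    refine ⟨x - x₀, ⟨G.sub_mem hx.1 hx₀.1, fun b' hb' => ?_⟩, sub_add_cancel _ _⟩
    rw [Pi.sub_apply, sub_eq_zero]
    by_cases h : b' = b
    · rw [h]
      exact hxb
    · rw [hx.2 b' ⟨hb', h⟩, hx₀.2 b' ⟨hb', h⟩]
  · choose x hx hxu using hu
    refine ⟨∑ b, x b, G.sum_mem fun b _ => (hx b).1, fun b => ?_⟩
    rw [Finset.sum_apply, Finset.sum_eq_single b, ← hxu b]
    · intro b' _ hb'
      exact (hx b').2 b ⟨b.2, fun h => hb' (Subtype.ext h).symm⟩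
    · simp

variable {L : Type*} [Field L] [IsSepClosed L] (p : ℕ) [Fact p.Prime] [CharP L p] {d D : ℕ}
  {σ : Type*} [Finite σ] {S : Set (σ → L)}

theorem mem_vanishingIdeal_of_closureTranslates (hd : 1 ≤ d) (hdD : d < D) (c : ℕ → L)
    (hcd : c d ≠ 0) (hcD : c D ≠ 0)
    (htor : {x : L | ∃ n, (specialTphi p d D c)^[n] x = 0}.Finite)
    (hS : ∀ s ∈ S, ∀ i n, s i ∈ Set.range ((specialTphi p d D c)^[n]))
    (hP : (vanishingIdeal L S).IsPrime) {s₀ : σ → L} (hs₀ : s₀ ∈ S)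
    {f : MvPolynomial σ L}
    (hf : ∀ x ∈ closureTranslates (AlgebraicClosure L) p S,
      aeval (fun i => x i + algebraMap L _ (s₀ i)) f = 0) : f ∈ vanishingIdeal L S := by
  obtain ⟨B, H, hB, hH, hu⟩ := exists_forall_eq_of_minimal
    (closureTranslates (AlgebraicClosure L) p S)
  have halg := isAlgebraic_of_finite_translates p hd hdD c hcd hcD htor hS hP (B₀ := B) hB
  set I := vanishingIdeal L S with hI
  set x : σ → MvPolynomial σ L ⧸ I := fun i => Ideal.Quotient.mk I (X i) with hx
  by_contra hfI
  have hmk : ∀ h : MvPolynomial σ L, Ideal.Quotient.mk I h = aeval x h := by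
    intro h
    have : Ideal.Quotient.mkₐ L I = aeval x := by
      ext i
      simp [hx]
    rw [← this]
    rfl
  have hfalg : IsAlgebraic (Algebra.adjoin L (x '' B)) (Ideal.Quotient.mk I f) := by
    rw [hmk, ← Subalgebra.mem_algebraicClosure]
    have hle : Algebra.adjoin L (Set.range x) ≤ (Subalgebra.algebraicClosure
        (Algebra.adjoin L (x '' B)) (MvPolynomial σ L ⧸ I)).restrictScalars L := by
      rw [Algebra.adjoin_le_iff]
      rintro _ ⟨i, rfl⟩
      exact halg i
    rw [Algebra.adjoin_range_eq_range_aeval] at hle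
    exact hle ⟨f, rfl⟩
  obtain ⟨⟨q, hq⟩, hq0, h, hh⟩ := hfalg.exists_nonzero_dvd
    (mem_nonZeroDivisors_of_ne_zero fun h => hfI (Ideal.Quotient.eq_zero_iff_mem.1 h))
  rw [Set.image_eq_range, Algebra.adjoin_range_eq_range_aeval] at hq
  obtain ⟨Q, rfl⟩ := hq
  obtain ⟨h, rfl⟩ := Ideal.Quotient.mk_surjective h
  have hQ : rename Subtype.val Q - f * h ∈ I := by
    rw [← Ideal.Quotient.eq_zero_iff_mem, map_sub, map_mul, ← hh, hmk, aeval_rename, sub_eq_zero]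
    rfl
  have hQ0 : Q ≠ 0 := by
    rintro rfl
    exact hq0 (Subtype.ext (map_zero _))
  apply hQ0
  apply map_injective (algebraMap L (AlgebraicClosure L)) (algebraMap L _).injective
  refine funext_set (fun b => (fun v => v + algebraMap L _ (s₀ b)) '' H b)
    (fun b => (hH b).image (add_left_injective _).injOn) fun v hv => ?_
  have hv' : ∀ b : B, v b - algebraMap L _ (s₀ b) ∈ H b := by
    intro b
    obtain ⟨w, hw, hwv⟩ := hv b trivial
    rwa [← hwv, add_sub_cancel_right]
  obtain ⟨y, hy, hyv⟩ := hu _ hv'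
  have h0 := mem_closureTranslates.1 hy _ hQ s₀ hs₀
  rw [map_sub, map_mul, hf y hy, zero_mul, sub_zero, aeval_rename] at h0
  rw [map_zero, map_zero, eval_map, ← aeval_def, ← h0]
  congr 2
  funext b
  rw [Function.comp_apply, hyv, sub_add_cancel]

theorem aeval_add_sub_eq_zero (hd : 1 ≤ d) (hdD : d < D) (c : ℕ → L)
    (hcd : c d ≠ 0) (hcD : c D ≠ 0)
    (htor : {x : L | ∃ n, (specialTphi p d D c)^[n] x = 0}.Finite)
    (hS : ∀ s ∈ S, ∀ i n, s i ∈ Set.range ((specialTphi p d D c)^[n]))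
    (hP : (vanishingIdeal L S).IsPrime) {f : MvPolynomial σ L} (hf : f ∈ vanishingIdeal L S)
    {s₀ s s' : σ → L} (hs₀ : s₀ ∈ S) (hs : s ∈ S) (hs' : s' ∈ S) : aeval (s' + (s - s₀)) f = 0 := by
  have h := mem_vanishingIdeal_of_closureTranslates p hd hdD c hcd hcD htor hS hP hs₀
    (f := aeval (fun i => X i + C ((s - s₀) i)) f) (fun x hx => by
      rw [aeval_aeval_X_add_C]
      rw [← mem_closureTranslates.1 hx f hf s hs]
      congr 2
      funext i
      rw [Pi.sub_apply, map_sub, add_assoc, add_sub_cancel]) s' hs'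
  rw [aeval_aeval_X_add_C] at h
  exact h

end Translates

section Intersections

open MvPolynomial

variable {L : Type*} [Field L] (p : ℕ) [Fact p.Prime] [CharP L p] (d D : ℕ) (c : ℕ → L)

theorem specialTphi_iterate_add (n : ℕ) (x y : L) : (specialTphi p d D c)^[n] (x + y) =
    (specialTphi p d D c)^[n] x + (specialTphi p d D c)^[n] y := by
  induction n generalizing x y with
  | zero => rfl
  | succ n ih =>
    rw [Function.iterate_succ_apply, Function.iterate_succ_apply, Function.iterate_succ_apply,
      ← ih]
    simp only [specialTphi, add_pow_char_pow, mul_add, Finset.sum_add_distrib]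

/-- The vectors whose coordinates are in the image of every iterate of `φ`. -/
def iterImages (σ : Type*) : AddSubgroup (σ → L) :=
  AddSubmonoid.toAddSubgroupOfCharP p
    { carrier := {x | ∀ i, x i ∈ ⋂ n : ℕ, Set.range ((specialTphi p d D c)^[n])}
      zero_mem' := fun i => Set.mem_iInter.2 fun n => ⟨0, by
        have := specialTphi_iterate_add p d D c n 0 0
        simpa using this⟩
      add_mem' := fun {x y} hx hy i => Set.mem_iInter.2 fun n => by
        obtain ⟨u, hu⟩ := Set.mem_iInter.1 (hx i) n
        obtain ⟨v, hv⟩ := Set.mem_iInter.1 (hy i) n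
        exact ⟨u + v, by rw [specialTphi_iterate_add, hu, hv, Pi.add_apply]⟩ }

variable {d D} {σ : Type*}

theorem exists_coset_eq [IsSepClosed L] [Finite σ] (hd : 1 ≤ d) (hdD : d < D)
    (hcd : c d ≠ 0) (hcD : c D ≠ 0)
    (htor : {x : L | ∃ n, (specialTphi p d D c)^[n] x = 0}.Finite)
    {T : Set (σ → L)} (hT : T ⊆ iterImages p d D c σ) (hP : (vanishingIdeal L T).IsPrime) :
    ∃ b ∈ iterImages p d D c σ, ∃ H ≤ iterImages p d D c σ, (fun h => b + h) '' (H : Set (σ → L)) =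
      {x | x ∈ iterImages p d D c σ ∧ ∀ f ∈ vanishingIdeal L T, aeval x f = 0} := by
  set S : Set (σ → L) := {x | x ∈ iterImages p d D c σ ∧ ∀ f ∈ vanishingIdeal L T, aeval x f = 0}
    with hS
  have hTS : T ⊆ S := fun t ht => ⟨hT ht, fun f hf => hf t ht⟩
  have hI : vanishingIdeal L S = vanishingIdeal L T :=
    le_antisymm (vanishingIdeal_anti_mono hTS) fun f hf s hs => hs.2 f hf
  obtain ⟨b, hb⟩ : T.Nonempty := by
    rw [Set.nonempty_iff_ne_empty]
    rintro rfl
    exact hP.ne_top vanishingIdeal_empty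
  let H : AddSubgroup (σ → L) := AddSubmonoid.toAddSubgroupOfCharP p
    { carrier := {h | h ∈ iterImages p d D c σ ∧ ∀ s ∈ S, h + s ∈ S}
      zero_mem' := ⟨zero_mem _, fun s hs => by rwa [zero_add]⟩
      add_mem' := fun {x y} hx hy => ⟨add_mem hx.1 hy.1, fun s hs => by
        rw [add_assoc]
        exact hx.2 _ (hy.2 s hs)⟩ }
  refine ⟨b, hT hb, H, fun h hh => hh.1, Set.ext fun s => ⟨?_, fun hs => ?_⟩⟩
  · rintro ⟨h, hh, rfl⟩
    change b + h ∈ S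
    rw [add_comm]
    exact hh.2 b (hTS hb)
  · refine ⟨s - b, ⟨sub_mem hs.1 (hT hb), fun s' hs' =>
      ⟨add_mem (sub_mem hs.1 (hT hb)) hs'.1, fun f hf => ?_⟩⟩, add_sub_cancel b s⟩
    rw [add_comm]
    exact aeval_add_sub_eq_zero p hd hdD c hcd hcD htor
      (fun s hs i => Set.mem_iInter.1 (hs.1 i)) (hI ▸ hP) (hI ▸ hf) (hTS hb) hs hs'

end Intersections

/-- Let `φ` be a Drinfeld module of special characteristic over `K` with
positive modular transcendence degree and `Φ[t^∞](K^sep)` finite.  Let `L/K` be a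
separably closed, fully separable field extension and `ψ^∞(L) = ⋂_n T_φ^{∘n}(L)`.  Then
for every `g ≥ 1` and every Zariski-closed subset `Y` of affine `g`-space defined over
`L`, the set `Y(L) ∩ (ψ^∞(L))^g` is a finite union of translates `b + H` with
`b ∈ (ψ^∞(L))^g` and `H` a subgroup of the additive group `(ψ^∞(L))^g`. -/
theorem stmt10 {K : Type*} [Field K] (p : ℕ) [Fact p.Prime] [CharP K p]
    (d D : ℕ) (hd : 1 ≤ d) (hdD : d ≤ D) (c : ℕ → K)
    (hcd : c d ≠ 0) (hcD : c D ≠ 0)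
    (hmod : PosModularTransc p d D c)
    -- `Φ[t^∞](K^sep)` is finite:
    (htor : {x : AlgebraicClosure K | x ∈ separableClosure K (AlgebraicClosure K) ∧
      ∃ n : ℕ, (specialTphi p d D (fun i => algebraMap K (AlgebraicClosure K) (c i)))^[n] x
        = 0}.Finite)
    (L : Type*) [Field L] [Algebra K L] [IsSepClosed L]
    (hfs : haveI : CharP L p := charP_of_injective_ringHom (algebraMap K L).injective p;
      FullySeparable p K L)
    (g : ℕ) (hg : 1 ≤ g) (I : Ideal (MvPolynomial (Fin g) L)) :
    letI ψ : Set L :=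
      ⋂ n : ℕ, Set.range ((specialTphi p d D (fun i => algebraMap K L (c i)))^[n])
    ∃ (n : ℕ) (b : Fin n → (Fin g → L)) (H : Fin n → AddSubgroup (Fin g → L)),
      (∀ k, ∀ i, b k i ∈ ψ) ∧
      (∀ k, ∀ h ∈ H k, ∀ i, h i ∈ ψ) ∧
      zeroLocusVia I (RingHom.id L) ∩ {x : Fin g → L | ∀ i, x i ∈ ψ} =
        ⋃ k, (fun h => b k + h) '' (H k : Set (Fin g → L)) := by
  have : CharP L p := charP_of_injective_ringHom (algebraMap K L).injective p
  set ψ : Set L :=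
    ⋂ n : ℕ, Set.range ((specialTphi p d D (fun i => algebraMap K L (c i)))^[n]) with hψ
  set c' : ℕ → L := fun i => algebraMap K L (c i) with hc'
  have hlt : d < D := lt_of_le_of_ne hdD (PosModularTransc.ne hd hcd hmod)
  have htorL : {x : L | ∃ n, (specialTphi p d D c')^[n] x = 0}.Finite :=
    finite_torsion_of_fullySeparable p hfs hdD c hcD htor
  have hne : ∀ {i}, c i ≠ 0 → c' i ≠ 0 := fun h => (map_ne_zero (algebraMap K L)).2 h
  obtain ⟨𝒯, hfin, hprime, hU⟩ := exists_finite_sUnion_isPrime_vanishingIdeal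
    (zeroLocusVia I (RingHom.id L) ∩ {x : Fin g → L | ∀ i, x i ∈ ψ})
  have hsub : ∀ T ∈ 𝒯, T ⊆ zeroLocusVia I (RingHom.id L) ∩ {x : Fin g → L | ∀ i, x i ∈ ψ} :=
    fun T hT => hU ▸ Set.subset_sUnion_of_mem hT
  have := hfin.to_subtype
  obtain ⟨n, ⟨e⟩⟩ := Finite.exists_equiv_fin 𝒯
  have hcoset := fun k => exists_coset_eq p c' hd hlt (hne hcd) (hne hcD) htorL
    (T := ((e.symm k : 𝒯) : Set (Fin g → L))) (fun t ht => (hsub _ (e.symm k).2 ht).2)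
    (hprime _ (e.symm k).2)
  choose b hb H hH hbH using hcoset
  refine ⟨n, b, H, hb, fun k h hh => hH k hh, Set.Subset.antisymm ?_ ?_⟩
  · intro x hx
    have hx' := hx
    rw [← hU] at hx'
    obtain ⟨T, hT, hxT⟩ := hx'
    refine Set.mem_iUnion.2 ⟨e ⟨T, hT⟩, ?_⟩
    rw [hbH, e.symm_apply_apply]
    exact ⟨hx.2, fun f hf => hf x hxT⟩
  · refine Set.iUnion_subset fun k => ?_
    rw [hbH]
    rintro x ⟨hxψ, hx⟩
    exact ⟨fun q hq => hx q fun t ht => (hsub _ (e.symm k).2 ht).1 q hq, hxψ⟩
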